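/- arXiv:1603.04532 — 15 statements merged into one kernel-verified Lean document; each statement's English description precedes it below -/
import Mathlib

section
/- For every integer l ≥ 1 and every real number t, the identity t·N_{A_l}(t) = (1/l!)·d^{l−1}/dt^{l−1}[ t^l (1−t)^l ] holds; that is, the polynomial t·N_{A_l}(t) equals 1/l! times the (l−1)-st derivative of the polynomial t^l(1−t)^l. (Rodrigues type formula for type A_l.) -/
open Polynomial

/-- The skew-growth function of the dual Artin monoid of type `A_l`:
`N_{A_l}(t) = ∑_{k=0}^{l} (−1)^k (1/l)·C(l,k)·C(l+k,k+1)·t^k`. -/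
noncomputable def NA (l : ℕ) : Polynomial ℝ :=
  ∑ k ∈ Finset.range (l + 1),
    Polynomial.C ((-1 : ℝ) ^ k * (1 / (l : ℝ)) * (l.choose k : ℝ) *
      ((l + k).choose (k + 1) : ℝ)) * X ^ k

theorem X_pow_mul_one_sub_X_pow_eq_sum {R : Type*} [CommRing R] (m n : ℕ) :
    (X ^ m * (1 - X) ^ n : R[X]) =
      ∑ k ∈ Finset.range (n + 1), C ((-1 : R) ^ k * (n.choose k : R)) * X ^ (m + k) := by
  rw [sub_eq_neg_add, add_pow, Finset.mul_sum]
  refine Finset.sum_congr rfl fun k _ => ?_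
  rw [neg_pow, one_pow, mul_one, pow_add]
  simp only [C_mul, C_pow, C_neg, C_1, C_eq_natCast]
  ring

theorem descFactorial_succ_add_eq (n k : ℕ) :
    (n + 1 + k).descFactorial n = n.factorial * (n + 1 + k).choose (k + 1) := by
  rw [Nat.descFactorial_eq_factorial_mul_choose, Nat.choose_symm_of_eq_add (b := k + 1) (by omega)]

/-- Rodrigues type formula for type `A_l`:
`t·N_{A_l}(t) = (1/l!)·(d/dt)^{l−1}[ t^l (1−t)^l ]`. -/
theorem rodrigues_A (l : ℕ) (hl : 1 ≤ l) (t : ℝ) :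
    t * (NA l).eval t =
      (1 / (Nat.factorial l : ℝ)) *
        (derivative^[l - 1] (X ^ l * (1 - X) ^ l : Polynomial ℝ)).eval t := by
  obtain ⟨n, rfl⟩ : ∃ n, l = n + 1 := ⟨l - 1, by omega⟩
  rw [X_pow_mul_one_sub_X_pow_eq_sum, iterate_derivative_sum, NA, eval_finsetSum,
    eval_finsetSum, Finset.mul_sum, Finset.mul_sum, Nat.add_sub_cancel]
  refine Finset.sum_congr rfl fun k _ => ?_
  rw [iterate_derivative_C_mul, iterate_derivative_X_pow_eq_C_mul, descFactorial_succ_add_eq,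
    show n + 1 + k - n = k + 1 by omega, Nat.factorial_succ]
  have hn : (n.factorial : ℝ) ≠ 0 := Nat.cast_ne_zero.mpr n.factorial_ne_zero
  have hn' : (n : ℝ) + 1 ≠ 0 := n.cast_add_one_ne_zero
  simp only [eval_mul, eval_C, eval_pow, eval_X]
  push_cast
  field_simp
  ring
end

section
/- For every integer l ≥ 4 and every real number t, the identity N_{D_l}(t) = (1/(l−2)!)·d^{l−2}/dt^{l−2}[ t^{l−2}(1−t)^l ] + (1/(l−3)!)·d^{l−3}/dt^{l−3}[ t^{l−1}(1−t)^{l−2} ] holds. (Rodrigues type formula for type D_l, two-term form.) -/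
open Polynomial

/-- The skew-growth function of the dual Artin monoid of type `D_l`:
`N_{D_l}(t) = ∑_{k=0}^{l} (−1)^k·(C(l,k)·C(l+k−2,k) + C(l−2,k−2)·C(l+k−3,k))·t^k`,
with the convention `C(n,j) = 0` for `j < 0`. -/
noncomputable def ND (l : ℕ) : Polynomial ℝ :=
  ∑ k ∈ Finset.range (l + 1),
    Polynomial.C ((-1 : ℝ) ^ k * ((l.choose k : ℝ) * ((l + k - 2).choose k : ℝ) +
      (if 2 ≤ k then ((l - 2).choose (k - 2) : ℝ) * ((l + k - 3).choose k : ℝ) else 0))) * X ^ k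

/-- Explicit expansion of the normalized derivative `(d/dt)^m [t^(m+r) (1-t)^n] / m!`. -/
theorem eval_iterate_derivative_X_pow_mul_one_sub_X_pow (m r n : ℕ) (t : ℝ) :
    (1 / (Nat.factorial m : ℝ)) *
        (derivative^[m] (X ^ (m + r) * (1 - X) ^ n : Polynomial ℝ)).eval t =
      ∑ j ∈ Finset.range (n + 1),
        (-1 : ℝ) ^ j * ((n.choose j : ℝ) * ((m + r + j).choose m : ℝ)) * t ^ (r + j) := by
  have expand : (X ^ (m + r) * (1 - X) ^ n : Polynomial ℝ) =
      ∑ j ∈ Finset.range (n + 1), monomial (m + r + j) ((-1 : ℝ) ^ j * (n.choose j : ℝ)) := by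
    rw [show (1 - X : Polynomial ℝ) = -X + 1 by ring, add_pow, Finset.mul_sum]
    refine Finset.sum_congr rfl fun j _ => ?_
    rw [← C_mul_X_pow_eq_monomial, neg_pow]
    simp only [map_mul, map_pow, map_neg, map_one, map_natCast, one_pow]
    ring
  have hm : (Nat.factorial m : ℝ) ≠ 0 := by positivity
  rw [← factorial_smul_hasseDeriv, expand, LinearMap.smul_apply, eval_smul, nsmul_eq_mul,
    ← mul_assoc, one_div_mul_cancel hm, one_mul, map_sum, eval_finsetSum]
  refine Finset.sum_congr rfl fun j _ => ?_
  rw [hasseDeriv_monomial, eval_monomial, show m + r + j - m = r + j by omega]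
  ring

/-- Rodrigues type formula for type `D_l` (two-term form):
`N_{D_l}(t) = (1/(l−2)!)·(d/dt)^{l−2}[ t^{l−2}(1−t)^l ] + (1/(l−3)!)·(d/dt)^{l−3}[ t^{l−1}(1−t)^{l−2} ]`. -/
theorem rodrigues_D_two_term (l : ℕ) (hl : 4 ≤ l) (t : ℝ) :
    (ND l).eval t =
      (1 / (Nat.factorial (l - 2) : ℝ)) *
        (derivative^[l - 2] (X ^ (l - 2) * (1 - X) ^ l : Polynomial ℝ)).eval t +
      (1 / (Nat.factorial (l - 3) : ℝ)) *
        (derivative^[l - 3] (X ^ (l - 1) * (1 - X) ^ (l - 2) : Polynomial ℝ)).eval t := by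
  obtain ⟨m, rfl⟩ : ∃ m, l = m + 3 := ⟨l - 3, by omega⟩
  have h₁ := eval_iterate_derivative_X_pow_mul_one_sub_X_pow (m + 1) 0 (m + 3) t
  have h₂ := eval_iterate_derivative_X_pow_mul_one_sub_X_pow m 2 (m + 1) t
  simp only [add_zero, zero_add] at h₁
  rw [show m + 3 - 2 = m + 1 by omega, show m + 3 - 3 = m by omega,
    show m + 3 - 1 = m + 2 by omega, h₁, h₂, ND, eval_finsetSum]
  simp only [eval_mul, eval_C, eval_pow, eval_X, mul_add, add_mul, Finset.sum_add_distrib]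
  congr 1
  · refine Finset.sum_congr rfl fun k _ => ?_
    rw [show m + 3 + k - 2 = m + 1 + k by omega, Nat.choose_symm_add]
  · rw [Finset.sum_range_succ', Finset.sum_range_succ']
    simp only [zero_add, Nat.not_ofNat_le_one, nonpos_iff_eq_zero, OfNat.ofNat_ne_zero,
      if_false, mul_zero, zero_mul, add_zero]
    refine Finset.sum_congr rfl fun j _ => ?_
    rw [if_pos (by omega), show j + 1 + 1 - 2 = j by omega, show m + 3 - 2 = m + 1 by omega,
      show m + 3 + (j + 1 + 1) - 3 = m + (2 + j) by omega,
      show j + 1 + 1 = 2 + j by omega, add_assoc m 2 j, Nat.choose_symm_add, pow_add (-1 : ℝ) 2 j]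
    ring
end

section
/- For every integer l ≥ 4 and every real number t, the identity N_{D_l}(t) = (1/(l−2)!)·d^{l−3}/dt^{l−3}[ t^{l−3}(1−t)^{l−2}·((l−2) − (3l−4)t + (3l−4)t²) ] holds. (Rodrigues type formula for type D_l, one-term form.) -/
open Polynomial

theorem coeff_one_sub_X_pow (n k : ℕ) :
    ((1 - X : ℝ[X]) ^ n).coeff k = (-1) ^ k * (n.choose k : ℝ) := by
  induction n generalizing k with
  | zero => cases k <;> simp [coeff_one]
  | succ n ih =>
    rw [pow_succ, mul_sub, mul_one, coeff_sub]
    cases k with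
    | zero => simp [ih]
    | succ k =>
      rw [coeff_mul_X, ih, ih, Nat.choose_succ_succ]
      push_cast
      ring

theorem coeff_ND (m k : ℕ) :
    (ND (m + 3)).coeff k = (-1 : ℝ) ^ k * (((m + 3).choose k : ℝ) * ((m + 1 + k).choose k : ℝ) +
      (if 2 ≤ k then ((m + 1).choose (k - 2) : ℝ) * ((m + k).choose k : ℝ) else 0)) := by
  have h₁ : m + 3 + k - 2 = m + 1 + k := by omega
  have h₂ : m + 3 + k - 3 = m + k := by omega
  simp only [ND, finsetSum_coeff, coeff_C_mul, coeff_X_pow, mul_ite, mul_one, mul_zero]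
  rw [Finset.sum_ite_eq]
  split_ifs with hk h2 h2
  · simp [h₁, h₂]
  · simp [h₁]
  · rw [Finset.mem_range] at hk
    rw [Nat.choose_eq_zero_of_lt (by omega : m + 3 < k),
      Nat.choose_eq_zero_of_lt (by omega : m + 1 < k - 2)]
    simp
  · rw [Finset.mem_range] at hk
    omega

/-- The coefficients of `(1 - X) ^ (m + 1) * (a - b * X + b * X ^ 2)`, with `a = m + 1` and
`b = 3 * m + 5`. -/
theorem coeff_rodrigues_factor (m k : ℕ) :
    ((1 - X : ℝ[X]) ^ (m + 1) * (Polynomial.C ((m : ℝ) + 1) - Polynomial.C (3 * (m : ℝ) + 5) * X +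
      Polynomial.C (3 * (m : ℝ) + 5) * X ^ 2)).coeff k =
    (-1) ^ k * ((m + 1 + k) * ((m + 3).choose k : ℝ) +
      (if 2 ≤ k then (m + 1) * ((m + 1).choose (k - 2) : ℝ) else 0)) := by
  have expand : (1 - X : ℝ[X]) ^ (m + 1) * (Polynomial.C ((m : ℝ) + 1) -
      Polynomial.C (3 * (m : ℝ) + 5) * X + Polynomial.C (3 * (m : ℝ) + 5) * X ^ 2) =
      Polynomial.C ((m : ℝ) + 1) * (1 - X) ^ (m + 1) -
      Polynomial.C (3 * (m : ℝ) + 5) * ((1 - X) ^ (m + 1) * X) +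
      Polynomial.C (3 * (m : ℝ) + 5) * ((1 - X) ^ (m + 1) * X * X) := by ring
  rw [expand, coeff_add, coeff_sub, coeff_C_mul, coeff_C_mul, coeff_C_mul]
  match k with
  | 0 => simp [coeff_one_sub_X_pow]
  | 1 =>
    rw [coeff_mul_X _ 0, coeff_mul_X _ 0, mul_coeff_zero, coeff_X_zero, coeff_one_sub_X_pow,
      coeff_one_sub_X_pow]
    simp
    ring
  | k + 2 =>
    have absorb : ((m : ℝ) + 3) * ((m + 2).choose (k + 1)) =
        (m + 3).choose (k + 2) * ((k : ℝ) + 2) := by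
      exact_mod_cast Nat.add_one_mul_choose_eq (m + 2) (k + 1)
    have pascal₂ : ((m + 2).choose (k + 1) : ℝ) =
        (m + 1).choose k + (m + 1).choose (k + 1) := by
      exact_mod_cast Nat.choose_succ_succ (m + 1) k
    have pascal₂' : ((m + 2).choose (k + 2) : ℝ) =
        (m + 1).choose (k + 1) + (m + 1).choose (k + 2) := by
      exact_mod_cast Nat.choose_succ_succ (m + 1) (k + 1)
    have pascal₃ : ((m + 3).choose (k + 2) : ℝ) =
        (m + 2).choose (k + 1) + (m + 2).choose (k + 2) := by
      exact_mod_cast Nat.choose_succ_succ (m + 2) (k + 1)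
    rw [pascal₃, pascal₂, pascal₂'] at absorb
    rw [pascal₃, pascal₂, pascal₂', coeff_mul_X, coeff_mul_X, coeff_mul_X,
      coeff_one_sub_X_pow, coeff_one_sub_X_pow, coeff_one_sub_X_pow,
      if_pos (Nat.le_add_left 2 k), Nat.add_sub_cancel]
    push_cast
    linear_combination (-1 : ℝ) ^ k * absorb

/-- Rodrigues type formula for type `D_l` (one-term form):
`N_{D_l}(t) = (1/(l−2)!)·(d/dt)^{l−3}[ t^{l−3}(1−t)^{l−2}·((l−2) − (3l−4)t + (3l−4)t²) ]`. -/
theorem rodrigues_D_one_term (l : ℕ) (hl : 4 ≤ l) (t : ℝ) :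
    (ND l).eval t =
      (1 / (Nat.factorial (l - 2) : ℝ)) *
        (derivative^[l - 3] (X ^ (l - 3) * (1 - X) ^ (l - 2) *
          (Polynomial.C ((l : ℝ) - 2) - Polynomial.C (3 * (l : ℝ) - 4) * X +
            Polynomial.C (3 * (l : ℝ) - 4) * X ^ 2) : Polynomial ℝ)).eval t := by
  obtain ⟨m, rfl⟩ := Nat.exists_eq_add_of_le' (show 3 ≤ l by omega)
  rw [← eval_C_mul]
  congr 1
  ext k
  have ha : ((m + 3 : ℕ) : ℝ) - 2 = m + 1 := by push_cast; ring
  have hb : 3 * ((m + 3 : ℕ) : ℝ) - 4 = 3 * m + 5 := by push_cast; ring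
  have hm : m + 3 - 2 = m + 1 := rfl
  have desc : ((k + m).descFactorial m : ℝ) = m.factorial * (m + k).choose k := by
    rw [Nat.descFactorial_eq_factorial_mul_choose, add_comm k m, Nat.choose_symm_add]
    push_cast
    rfl
  have absorb : ((m : ℝ) + 1 + k) * (m + k).choose k = (m + 1 + k).choose k * (m + 1) := by
    have h := Nat.add_one_mul_choose_eq (m + k) m
    rw [Nat.choose_symm_add, show m + k + 1 = m + 1 + k by ring, Nat.choose_symm_add] at h
    exact_mod_cast h
  rw [coeff_ND, coeff_C_mul, ha, hb, hm, Nat.add_sub_cancel, coeff_iterate_derivative, mul_assoc,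
    coeff_X_pow_mul, coeff_rodrigues_factor, nsmul_eq_mul, desc, Nat.factorial_succ]
  have hf : (m.factorial : ℝ) ≠ 0 := by positivity
  have hm1 : (m : ℝ) + 1 ≠ 0 := by positivity
  push_cast
  field_simp
  split_ifs
  · linear_combination -((m + 3).choose k : ℝ) * absorb
  · linear_combination -((m + 3).choose k : ℝ) * absorb
end

section
/- For every integer l ≥ 1, the three-term recurrence relation (l+3)·N_{A_{l+2}}(t) = −(2l+3)(2t−1)·N_{A_{l+1}}(t) − l·N_{A_l}(t) holds as an identity of real polynomials in t. -/
open Polynomial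

theorem coeff_NA (l k : ℕ) :
    (NA l).coeff k = (-1 : ℝ) ^ k * (1 / (l : ℝ)) * (l.choose k : ℝ) *
      ((l + k).choose (k + 1) : ℝ) := by
  simp only [NA, finsetSum_coeff, coeff_C_mul_X_pow]
  rw [Finset.sum_ite_eq]
  split_ifs with h
  · rfl
  · rw [Nat.choose_eq_zero_of_lt (by simpa [Nat.lt_succ_iff] using h)]
    simp

theorem coeff_NA_of_lt {l k : ℕ} (h : l < k) : (NA l).coeff k = 0 := by
  rw [coeff_NA, Nat.choose_eq_zero_of_lt h]
  simp

theorem coeff_NA_add (k m : ℕ) (h : k + m ≠ 0) :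
    (NA (k + m)).coeff k = (-1 : ℝ) ^ k * ((2 * k + m).factorial : ℝ) /
      (k.factorial * (k + 1).factorial * m.factorial) := by
  obtain ⟨n, hn⟩ := Nat.exists_eq_succ_of_ne_zero h
  have h₁ : ((k + m).choose k : ℝ) = (n + 1).factorial / (k.factorial * m.factorial) := by
    rw [Nat.cast_add_choose, hn]
  have h₂ : ((k + m + k).choose (k + 1) : ℝ) =
      (2 * k + m).factorial / ((k + 1).factorial * n.factorial) := by
    rw [show k + m + k = (k + 1) + n by omega, Nat.cast_add_choose,
      show (k + 1) + n = 2 * k + m by omega]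
  have h₃ : ((k + m : ℕ) : ℝ) = n + 1 := by rw [hn]; push_cast; rfl
  have hk := Nat.cast_ne_zero (R := ℝ).2 k.factorial_ne_zero
  have hk₁ := Nat.cast_ne_zero (R := ℝ).2 (k + 1).factorial_ne_zero
  have hm := Nat.cast_ne_zero (R := ℝ).2 m.factorial_ne_zero
  have hn₀ := Nat.cast_ne_zero (R := ℝ).2 n.factorial_ne_zero
  have hn₁ : (n : ℝ) + 1 ≠ 0 := by positivity
  rw [coeff_NA, h₁, h₂, h₃, Nat.factorial_succ n]
  push_cast
  field_simp

theorem coeff_NA_zero {l : ℕ} (hl : l ≠ 0) : (NA l).coeff 0 = 1 := by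
  simp [coeff_NA, hl]

theorem coeff_NA_recurrence (l k : ℕ) :
    ((l : ℝ) + 3) * (NA (l + 2)).coeff (k + 1) =
      (2 * (l : ℝ) + 3) * ((NA (l + 1)).coeff (k + 1) - 2 * (NA (l + 1)).coeff k) -
        l * (NA l).coeff (k + 1) := by
  have hk := Nat.cast_ne_zero (R := ℝ).2 k.factorial_ne_zero
  rcases lt_trichotomy k l with h | rfl | h
  · obtain ⟨m, rfl⟩ := Nat.exists_eq_add_of_le (Nat.succ_le_of_lt h)
    have hm := Nat.cast_ne_zero (R := ℝ).2 m.factorial_ne_zero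
    have e₂ := coeff_NA_add (k + 1) (m + 2) (by omega)
    have e₁ := coeff_NA_add (k + 1) (m + 1) (by omega)
    have e₁' := coeff_NA_add k (m + 2) (by omega)
    have e₀ := coeff_NA_add (k + 1) m (by omega)
    rw [show 2 * (k + 1) + (m + 2) = 2 * k + m + 2 + 1 + 1 by ring] at e₂
    rw [show 2 * (k + 1) + (m + 1) = 2 * k + m + 2 + 1 by ring] at e₁
    rw [show 2 * k + (m + 2) = 2 * k + m + 2 by ring] at e₁'
    rw [show 2 * (k + 1) + m = 2 * k + m + 2 by ring] at e₀
    rw [show k.succ + m + 2 = k + 1 + (m + 2) by omega, e₂,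
      show k.succ + m + 1 = k + 1 + (m + 1) by omega, e₁,
      show k + 1 + (m + 1) = k + (m + 2) by omega, e₁', Nat.succ_eq_add_one, e₀]
    generalize hF : 2 * k + m + 2 = F
    have hF' : (F : ℝ) = 2 * k + m + 2 := by rw [← hF]; push_cast; ring
    simp only [Nat.factorial_succ, pow_succ]
    push_cast
    rw [hF']
    field_simp
    ring
  · have e₂ := coeff_NA_add (k + 1) 1 (by omega)
    have e₁ := coeff_NA_add (k + 1) 0 (by omega)
    have e₁' := coeff_NA_add k 1 (by omega)
    rw [show 2 * (k + 1) + 1 = 2 * k + 1 + 1 + 1 by ring] at e₂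
    rw [show 2 * (k + 1) + 0 = 2 * k + 1 + 1 by ring, add_zero] at e₁
    rw [coeff_NA_of_lt (Nat.lt_succ_self k), e₂, e₁, e₁']
    simp only [Nat.factorial_succ, Nat.factorial_zero, pow_succ]
    push_cast
    field_simp
    ring
  · rcases (Nat.succ_le_of_lt h).eq_or_lt with rfl | h'
    · have e₂ := coeff_NA_add (l + 2) 0 (by omega)
      have e₁ := coeff_NA_add (l + 1) 0 (by omega)
      have hl := Nat.cast_ne_zero (R := ℝ).2 l.factorial_ne_zero
      rw [show 2 * (l + 2) + 0 = 2 * l + 2 + 1 + 1 by ring, add_zero] at e₂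
      rw [show 2 * (l + 1) + 0 = 2 * l + 2 by ring, add_zero] at e₁
      simp only [Nat.succ_eq_add_one, add_assoc, Nat.reduceAdd] at *
      rw [coeff_NA_of_lt (l := l) (by omega), coeff_NA_of_lt (l := l + 1) (by omega), e₂, e₁,
        show 2 * l + 4 = 2 * l + 2 + 1 + 1 by ring]
      simp only [Nat.factorial_succ, Nat.factorial_zero, pow_succ]
      push_cast
      field_simp
      ring
    · rw [coeff_NA_of_lt (l := l + 2) (by omega), coeff_NA_of_lt (l := l + 1) (by omega),
        coeff_NA_of_lt (l := l + 1) (k := k) (by omega), coeff_NA_of_lt (l := l) (by omega)]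
      ring

/-- Three-term recurrence for type `A_l`:
`(l+3)·N_{A_{l+2}}(t) = −(2l+3)(2t−1)·N_{A_{l+1}}(t) − l·N_{A_l}(t)`. -/
theorem recurrence_A (l : ℕ) (hl : 1 ≤ l) :
    Polynomial.C ((l : ℝ) + 3) * NA (l + 2) =
      -(Polynomial.C (2 * (l : ℝ) + 3) * (2 * X - 1)) * NA (l + 1) -
        Polynomial.C (l : ℝ) * NA l := by
  ext k
  rw [show -(C (2 * (l : ℝ) + 3) * (2 * X - 1)) * NA (l + 1) =
    C (2 * (l : ℝ) + 3) * (NA (l + 1) - C 2 * (X * NA (l + 1))) by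
      rw [show (C 2 : ℝ[X]) = 2 from rfl]; ring]
  simp only [coeff_sub, coeff_C_mul]
  cases k with
  | zero =>
    rw [coeff_NA_zero (by omega), coeff_NA_zero (by omega), coeff_NA_zero (by omega),
      coeff_X_mul_zero]
    ring
  | succ k => rw [coeff_X_mul, coeff_NA_recurrence]
end

section
/- For every integer l ≥ 2, the three-term recurrence relation (l+2)·N_{B_{l+2}}(t) = −(2l+3)·( 2t − 2(2l²+4l+1)/((2l+1)(2l+3)) )·N_{B_{l+1}}(t) − (l(2l+3)/(2l+1))·N_{B_l}(t) holds as an identity of real polynomials in t. -/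
open Polynomial

/-- The skew-growth function of the dual Artin monoid of type `B_l`:
`N_{B_l}(t) = ∑_{k=0}^{l} (−1)^k·C(l,k)·C(l+k−1,k)·t^k`. -/
noncomputable def NB (l : ℕ) : Polynomial ℝ :=
  ∑ k ∈ Finset.range (l + 1),
    Polynomial.C ((-1 : ℝ) ^ k * (l.choose k : ℝ) * ((l + k - 1).choose k : ℝ)) * X ^ k

theorem NB_coeff (l k : ℕ) :
    (NB l).coeff k = (-1 : ℝ) ^ k * (l.choose k : ℝ) * ((l + k - 1).choose k : ℝ) := by
  simp only [NB, finsetSum_coeff, coeff_C_mul_X_pow, Finset.sum_ite_eq, Finset.mem_range]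
  split_ifs with h
  · rfl
  · rw [Nat.choose_eq_zero_of_lt (by omega : l < k)]
    simp

theorem NB_coeff_zero (l : ℕ) : (NB l).coeff 0 = 1 := by
  simp [NB_coeff]

/-- Consecutive coefficients of `N_{B_l}` have ratio `(k² - l²) / (k + 1)²`. -/
theorem NB_coeff_succ {l : ℕ} (hl : 1 ≤ l) (k : ℕ) :
    ((k : ℝ) + 1) ^ 2 * (NB l).coeff (k + 1) = ((k : ℝ) ^ 2 - (l : ℝ) ^ 2) * (NB l).coeff k := by
  have h₁ : (l.choose (k + 1) : ℝ) * (k + 1) = l.choose k * ((l : ℝ) - k) := by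
    rcases le_or_gt k l with h | h
    · have := Nat.choose_succ_right_eq l k
      rw [← Nat.cast_sub h]
      exact_mod_cast this
    · simp [Nat.choose_eq_zero_of_lt h, Nat.choose_eq_zero_of_lt (h.trans k.lt_succ_self)]
  have h₂ : ((l + k).choose (k + 1) : ℝ) * (k + 1) = ((l : ℝ) + k) * (l + k - 1).choose k := by
    have := Nat.add_one_mul_choose_eq (l + k - 1) k
    rw [Nat.sub_add_cancel (by omega : 1 ≤ l + k)] at this
    exact_mod_cast this.symm
  rw [NB_coeff, NB_coeff, show l + (k + 1) - 1 = l + k by omega, pow_succ (-1 : ℝ)]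
  linear_combination (-(-1 : ℝ) ^ k * ((l + k).choose (k + 1) : ℝ) * (k + 1)) * h₁ -
    (-1 : ℝ) ^ k * l.choose k * ((l : ℝ) - k) * h₂

/-- The coefficients entering the three-term recurrence are explicit multiples of a common
factor. -/
theorem NB_coeff_common_factor {l : ℕ} (hl : 1 ≤ l) (k : ℕ) :
    ∃ w : ℝ, (NB (l + 1)).coeff k = (l + 1) * w ∧
      ((k : ℝ) + 1) ^ 2 * (NB (l + 2)).coeff (k + 1) = -((l + 2) * w * (l + k + 1) * (l + k + 2)) ∧
      ((k : ℝ) + 1) ^ 2 * (NB (l + 1)).coeff (k + 1) = -((l + 1) * w * (l + 1 - k) * (l + k + 1)) ∧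
      ((k : ℝ) + 1) ^ 2 * (NB l).coeff (k + 1) = -(l * w * (l - k) * (l - k + 1)) := by
  induction k with
  | zero =>
    have h₀ := NB_coeff_succ hl 0
    have h₁ := NB_coeff_succ (by omega : 1 ≤ l + 1) 0
    have h₂ := NB_coeff_succ (by omega : 1 ≤ l + 2) 0
    rw [NB_coeff_zero] at h₀ h₁ h₂
    have : (l : ℝ) + 1 ≠ 0 := by positivity
    refine ⟨1 / (l + 1), ?_, ?_, ?_, ?_⟩
    · rw [NB_coeff_zero]
      field_simp
    · rw [h₂]
      push_cast
      field_simp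
      ring
    · rw [h₁]
      push_cast
      field_simp
      ring
    · rw [h₀]
      push_cast
      field_simp
      ring
  | succ k ih =>
    obtain ⟨w, -, h₂, h₁, h₀⟩ := ih
    have hk : ((k : ℝ) + 1) ^ 2 ≠ 0 := by positivity
    refine ⟨-(w * (l + 1 - k) * (l + k + 1)) / ((k : ℝ) + 1) ^ 2, ?_, ?_, ?_, ?_⟩
    · apply mul_left_cancel₀ hk
      rw [h₁]
      field_simp
    · rw [NB_coeff_succ (by omega), eq_div_of_mul_eq hk ((mul_comm _ _).trans h₂)]
      push_cast
      field_simp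
      ring
    · rw [NB_coeff_succ (by omega), eq_div_of_mul_eq hk ((mul_comm _ _).trans h₁)]
      push_cast
      field_simp
      ring
    · rw [NB_coeff_succ hl, eq_div_of_mul_eq hk ((mul_comm _ _).trans h₀)]
      push_cast
      field_simp
      ring

/-- Three-term recurrence for type `B_l`:
`(l+2)·N_{B_{l+2}}(t) = −(2l+3)(2t − 2(2l²+4l+1)/((2l+1)(2l+3)))·N_{B_{l+1}}(t) − (l(2l+3)/(2l+1))·N_{B_l}(t)`. -/
theorem recurrence_B (l : ℕ) (hl : 2 ≤ l) :
    Polynomial.C ((l : ℝ) + 2) * NB (l + 2) =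
      -(Polynomial.C (2 * (l : ℝ) + 3) *
          (2 * X - Polynomial.C (2 * (2 * (l : ℝ) ^ 2 + 4 * l + 1) /
            ((2 * (l : ℝ) + 1) * (2 * (l : ℝ) + 3))))) * NB (l + 1) -
        Polynomial.C ((l : ℝ) * (2 * (l : ℝ) + 3) / (2 * (l : ℝ) + 1)) * NB l := by
  have h₁ : 2 * (l : ℝ) + 1 ≠ 0 := by positivity
  have h₃ : 2 * (l : ℝ) + 3 ≠ 0 := by positivity
  have expand (a b c : ℝ) (p q : ℝ[X]) : -(C a * (2 * X - C b)) * p - C c * q =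
      C (a * b) * p - C (2 * a) * (X * p) - C c * q := by
    simp only [C_mul, C_ofNat]
    ring
  rw [expand]
  ext k
  cases k with
  | zero =>
    simp only [coeff_sub, coeff_C_mul, coeff_X_mul_zero, NB_coeff_zero]
    field_simp
    ring
  | succ k =>
    simp only [coeff_sub, coeff_C_mul, coeff_X_mul]
    obtain ⟨w, e, e₂, e₁, e₀⟩ := NB_coeff_common_factor (by omega : 1 ≤ l) k
    have hk : ((k : ℝ) + 1) ^ 2 ≠ 0 := by positivity
    rw [e, eq_div_of_mul_eq hk ((mul_comm _ _).trans e₂),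
      eq_div_of_mul_eq hk ((mul_comm _ _).trans e₁),
      eq_div_of_mul_eq hk ((mul_comm _ _).trans e₀)]
    field_simp
    ring
end

section
/- For every integer l ≥ 4, the four-term recurrence relation N_{D_{l+3}}(t) = (a_l + b_l·t)·N_{D_{l+2}}(t) + (c_l + d_l·t + e_l·t²)·N_{D_{l+1}}(t) + (f_l + g_l·t)·N_{D_l}(t) holds as an identity of real polynomials in t, where, writing Q_l := (l+3)(43l³ − 35l² − 36l − 32), the coefficients are a_l = (l+2)(43l³ − 78l² − 129l − 24)/Q_l, b_l = −(86l⁴ + 145l³ − 196l² − 623l − 456)/Q_l, c_l = l(43l³ + 180l² + 45l + 56)/Q_l, d_l = −2l(172l³ + 333l² − 23l − 32)/Q_l, e_l = 2(2l−1)(2l+1)(43l² + 51l − 24)/Q_l, f_l = −(l−1)(43l³ + 137l² + 38l − 48)/Q_l, and g_l = (l−1)(2l+1)(43l² + 51l − 24)/Q_l. -/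
open Polynomial

/-- `Q_l = (l+3)(43l³ − 35l² − 36l − 32)`. -/
noncomputable def QD (l : ℕ) : ℝ :=
  ((l : ℝ) + 3) * (43 * (l : ℝ) ^ 3 - 35 * (l : ℝ) ^ 2 - 36 * (l : ℝ) - 32)

noncomputable def aD (l : ℕ) : ℝ :=
  ((l : ℝ) + 2) * (43 * (l : ℝ) ^ 3 - 78 * (l : ℝ) ^ 2 - 129 * (l : ℝ) - 24) / QD l

noncomputable def bD (l : ℕ) : ℝ :=
  -(86 * (l : ℝ) ^ 4 + 145 * (l : ℝ) ^ 3 - 196 * (l : ℝ) ^ 2 - 623 * (l : ℝ) - 456) / QD l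

noncomputable def cD (l : ℕ) : ℝ :=
  (l : ℝ) * (43 * (l : ℝ) ^ 3 + 180 * (l : ℝ) ^ 2 + 45 * (l : ℝ) + 56) / QD l

noncomputable def dD (l : ℕ) : ℝ :=
  -(2 * (l : ℝ) * (172 * (l : ℝ) ^ 3 + 333 * (l : ℝ) ^ 2 - 23 * (l : ℝ) - 32)) / QD l

noncomputable def eD (l : ℕ) : ℝ :=
  2 * (2 * (l : ℝ) - 1) * (2 * (l : ℝ) + 1) * (43 * (l : ℝ) ^ 2 + 51 * (l : ℝ) - 24) / QD l

noncomputable def fD (l : ℕ) : ℝ :=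
  -(((l : ℝ) - 1) * (43 * (l : ℝ) ^ 3 + 137 * (l : ℝ) ^ 2 + 38 * (l : ℝ) - 48)) / QD l

noncomputable def gD (l : ℕ) : ℝ :=
  ((l : ℝ) - 1) * (2 * (l : ℝ) + 1) * (43 * (l : ℝ) ^ 2 + 51 * (l : ℝ) - 24) / QD l

/-- The absolute value of the coefficient of `t ^ k` in `ND l`. -/
noncomputable def absCoeffND (l k : ℕ) : ℝ :=
  (l.choose k : ℝ) * ((l + k - 2).choose k : ℝ) +
    (if 2 ≤ k then ((l - 2).choose (k - 2) : ℝ) * ((l + k - 3).choose k : ℝ) else 0)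

lemma absCoeffND_of_lt {l k : ℕ} (hl : 2 ≤ l) (h : l < k) : absCoeffND l k = 0 := by
  simp [absCoeffND, Nat.choose_eq_zero_of_lt h,
    Nat.choose_eq_zero_of_lt (show l - 2 < k - 2 by omega)]

lemma coeff_ND_s6 {l : ℕ} (hl : 2 ≤ l) (k : ℕ) :
    (ND l).coeff k = (-1) ^ k * absCoeffND l k := by
  simp only [ND, finsetSum_coeff, coeff_C_mul_X_pow, Finset.sum_ite_eq, Finset.mem_range]
  split_ifs with h h₂
  · simp [absCoeffND, h₂]
  · simp [absCoeffND, h₂]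
  · rw [absCoeffND_of_lt hl (by omega), mul_zero]

lemma absCoeffND_zero (l : ℕ) : absCoeffND l 0 = 1 := by simp [absCoeffND]

lemma absCoeffND_one {l : ℕ} (hl : 1 ≤ l) : absCoeffND l 1 = l * (l - 1) := by
  obtain ⟨m, rfl⟩ := Nat.exists_eq_add_of_le' hl
  simp [absCoeffND]

/-- The factorial form of the coefficients, for `k ≤ l` with `l = m + 3`. -/
lemma absCoeffND_eq_factorial (k n m : ℕ) (h : k + n = m + 3) :
    absCoeffND (m + 3) k = (m + k).factorial / (k.factorial ^ 2 * n.factorial) *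
      ((m + 3) * (m + 2) * (m + k + 1) + (m + 1) * k * (k - 1)) := by
  have hf (i : ℕ) : (i.factorial : ℝ) ≠ 0 := mod_cast i.factorial_ne_zero
  have h₁ : ((m + 3).choose k : ℝ) = (m + 3).factorial / (k.factorial * n.factorial) := by
    rw [← h, Nat.cast_add_choose]
  have h₂ : ((m + 3 + k - 2).choose k : ℝ) =
      (m + k + 1).factorial / (k.factorial * (m + 1).factorial) := by
    rw [show m + 3 + k - 2 = k + (m + 1) by omega, Nat.cast_add_choose,
      show k + (m + 1) = m + k + 1 by omega]
  have h₃ : ((m + 3 + k - 3).choose k : ℝ) =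
      (m + k).factorial / (k.factorial * m.factorial) := by
    rw [show m + 3 + k - 3 = k + m by omega, Nat.cast_add_choose, add_comm k m]
  rw [absCoeffND, h₁, h₂, h₃]
  rcases k with _ | _ | k
  · obtain rfl : n = m + 3 := by omega
    have := hf m
    simp [Nat.factorial_succ]
    field_simp
    ring
  · obtain rfl : n = m + 2 := by omega
    have := hf m
    simp [Nat.factorial_succ]
    field_simp
    ring
  · have h₄ : ((m + 3 - 2).choose (k + 2 - 2) : ℝ) =
        (m + 1).factorial / (k.factorial * n.factorial) := by
      rw [show m + 3 - 2 = k + n by omega, Nat.add_sub_cancel, Nat.cast_add_choose,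
        show k + n = m + 1 by omega]
    rw [if_pos (by omega), h₄]
    have := hf m
    have := hf k
    have := hf n
    have := hf (m + (k + 2))
    simp only [Nat.factorial_succ, Nat.cast_mul, Nat.cast_add, Nat.cast_one, Nat.cast_ofNat] at *
    field_simp
    ring

/-- A form of the coefficients valid also for `l < k`, with denominators depending only on
`d = l + s - k`. -/
lemma absCoeffND_eq_descFactorial (m k d s : ℕ) (h : m + 3 + s = k + d) :
    absCoeffND (m + 3) k =
      (m + k).factorial * d.descFactorial s / (k.factorial ^ 2 * d.factorial) *
        ((m + 3) * (m + 2) * (m + k + 1) + (m + 1) * k * (k - 1)) := by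
  rcases le_or_gt s d with hs | hs
  · obtain ⟨n, rfl⟩ := Nat.exists_eq_add_of_le hs
    rw [absCoeffND_eq_factorial k n m (by omega)]
    have hn : (n.factorial : ℝ) ≠ 0 := mod_cast n.factorial_ne_zero
    have hk : (k.factorial : ℝ) ≠ 0 := mod_cast k.factorial_ne_zero
    have hd : ((s + n).factorial : ℝ) ≠ 0 := mod_cast (s + n).factorial_ne_zero
    have := Nat.factorial_mul_descFactorial hs
    rw [Nat.add_sub_cancel_left] at this
    have : (n.factorial : ℝ) * (s + n).descFactorial s = (s + n).factorial := mod_cast this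
    congr 1
    rw [← this] at hd ⊢
    field_simp [right_ne_zero_of_mul hd]
  · rw [absCoeffND_of_lt (by omega) (by omega), Nat.descFactorial_of_lt hs]
    simp

lemma QD_ne_zero {l : ℕ} (hl : 4 ≤ l) : QD l ≠ 0 := by
  obtain ⟨m, rfl⟩ := Nat.exists_eq_add_of_le' hl
  have : QD (m + 4) = (m + 7) * (43 * m ^ 3 + 481 * m ^ 2 + 1748 * m + 2016) := by
    simp only [QD]; push_cast; ring
  rw [this]
  positivity

lemma absCoeffND_recurrence {l : ℕ} (hl : 4 ≤ l) (j : ℕ) :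
    absCoeffND (l + 3) (j + 2) =
      aD l * absCoeffND (l + 2) (j + 2) - bD l * absCoeffND (l + 2) (j + 1) +
      (cD l * absCoeffND (l + 1) (j + 2) - dD l * absCoeffND (l + 1) (j + 1) +
        eD l * absCoeffND (l + 1) j) +
      (fD l * absCoeffND l (j + 2) - gD l * absCoeffND l (j + 1)) := by
  rcases lt_or_ge (l + 1) j with hj | hj
  · repeat rw [absCoeffND_of_lt (by omega) (by omega)]
    ring
  obtain ⟨d, hd⟩ := Nat.exists_eq_add_of_le hj
  have hQ := QD_ne_zero hl
  obtain ⟨m, rfl⟩ := Nat.exists_eq_add_of_le' (show 3 ≤ l by omega)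
  rw [absCoeffND_eq_descFactorial (m + 3) (j + 2) d 0 (by omega),
    absCoeffND_eq_descFactorial (m + 2) (j + 2) d 1 (by omega),
    absCoeffND_eq_descFactorial (m + 2) (j + 1) d 0 (by omega),
    absCoeffND_eq_descFactorial (m + 1) (j + 2) d 2 (by omega),
    absCoeffND_eq_descFactorial (m + 1) (j + 1) d 1 (by omega),
    absCoeffND_eq_descFactorial (m + 1) j d 0 (by omega),
    absCoeffND_eq_descFactorial m (j + 2) d 3 (by omega),
    absCoeffND_eq_descFactorial m (j + 1) d 2 (by omega)]
  have hd' : (d : ℝ) = m + 4 - j := by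
    have : ((m + 3 + 1 : ℕ) : ℝ) = (j + d : ℕ) := by rw [hd]
    push_cast at this
    linarith
  have h₁ : (d.descFactorial 1 : ℝ) = m + 4 - j := by simp [hd']
  have h₂ : (d.descFactorial 2 : ℝ) = (m + 4 - j) * (m + 3 - j) := by
    rw [Nat.cast_descFactorial_two, hd']; ring
  have h₃ : (d.descFactorial 3 : ℝ) = (m + 4 - j) * (m + 3 - j) * (m + 2 - j) := by
    rw [← descPochhammer_eval_eq_descFactorial]
    simp [descPochhammer_succ_right, hd']
    ring
  rw [h₁, h₂, h₃]
  have e₁ : m + 3 + (j + 2) = m + j + 1 + 1 + 1 + 1 + 1 := by ring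
  have e₂ : m + 2 + (j + 2) = m + j + 1 + 1 + 1 + 1 := by ring
  have e₃ : m + 2 + (j + 1) = m + j + 1 + 1 + 1 := by ring
  have e₄ : m + 1 + (j + 2) = m + j + 1 + 1 + 1 := by ring
  have e₅ : m + 1 + (j + 1) = m + j + 1 + 1 := by ring
  have e₆ : m + 1 + j = m + j + 1 := by ring
  have e₇ : m + (j + 2) = m + j + 1 + 1 := by ring
  have e₈ : m + (j + 1) = m + j + 1 := by ring
  rw [e₁, e₂, e₃, e₄, e₅, e₆, e₇, e₈]
  have hj₀ : (j.factorial : ℝ) ≠ 0 := mod_cast j.factorial_ne_zero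
  have hd₀ : (d.factorial : ℝ) ≠ 0 := mod_cast d.factorial_ne_zero
  have hj₁ : (j : ℝ) + 1 ≠ 0 := by positivity
  have hj₂ : (j : ℝ) + 1 + 1 ≠ 0 := by positivity
  simp only [Nat.factorial_succ, Nat.descFactorial_zero, aD, bD, cD, dD, eD, fD, gD]
  push_cast
  field_simp
  simp only [QD]
  push_cast
  ring

lemma absCoeffND_recurrence_zero {l : ℕ} (hl : 4 ≤ l) : 1 = aD l + cD l + fD l := by
  have hQ := QD_ne_zero hl
  simp only [aD, cD, fD]
  field_simp
  simp only [QD]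
  ring

lemma absCoeffND_recurrence_one {l : ℕ} (hl : 4 ≤ l) :
    absCoeffND (l + 3) 1 =
      aD l * absCoeffND (l + 2) 1 - bD l +
      (cD l * absCoeffND (l + 1) 1 - dD l) +
      (fD l * absCoeffND l 1 - gD l) := by
  have hQ := QD_ne_zero hl
  repeat rw [absCoeffND_one (by omega)]
  simp only [aD, bD, cD, dD, fD, gD]
  push_cast
  field_simp
  simp only [QD]
  ring

/-- Four-term recurrence for type `D_l`:
`N_{D_{l+3}}(t) = (a_l + b_l t)·N_{D_{l+2}}(t) + (c_l + d_l t + e_l t²)·N_{D_{l+1}}(t)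
  + (f_l + g_l t)·N_{D_l}(t)`. -/
theorem recurrence_D (l : ℕ) (hl : 4 ≤ l) :
    ND (l + 3) =
      (Polynomial.C (aD l) + Polynomial.C (bD l) * X) * ND (l + 2) +
      (Polynomial.C (cD l) + Polynomial.C (dD l) * X + Polynomial.C (eD l) * X ^ 2) * ND (l + 1) +
      (Polynomial.C (fD l) + Polynomial.C (gD l) * X) * ND l := by
  have h0 : 2 ≤ l := by omega
  have h1 : 2 ≤ l + 1 := by omega
  have h2 : 2 ≤ l + 2 := by omega
  have h3 : 2 ≤ l + 3 := by omega
  ext k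
  rw [show (C (aD l) + C (bD l) * X) * ND (l + 2) +
      (C (cD l) + C (dD l) * X + C (eD l) * X ^ 2) * ND (l + 1) +
      (C (fD l) + C (gD l) * X) * ND l =
      C (aD l) * ND (l + 2) + C (bD l) * (ND (l + 2) * X) +
      (C (cD l) * ND (l + 1) + C (dD l) * (ND (l + 1) * X) +
        C (eD l) * (ND (l + 1) * X * X)) +
      (C (fD l) * ND l + C (gD l) * (ND l * X)) by ring]
  simp only [coeff_add, coeff_C_mul]
  rcases k with _ | _ | j
  · simp only [coeff_mul_X_zero, coeff_ND_s6 h0, coeff_ND_s6 h1, coeff_ND_s6 h2, coeff_ND_s6 h3,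
      absCoeffND_zero]
    linear_combination absCoeffND_recurrence_zero hl
  · simp only [coeff_mul_X, coeff_mul_X_zero, coeff_ND_s6 h0, coeff_ND_s6 h1, coeff_ND_s6 h2,
      coeff_ND_s6 h3, absCoeffND_zero]
    linear_combination -absCoeffND_recurrence_one hl
  · simp only [coeff_mul_X, coeff_ND_s6 h0, coeff_ND_s6 h1, coeff_ND_s6 h2, coeff_ND_s6 h3]
    linear_combination (-1) ^ j * absCoeffND_recurrence hl j
end

section
/- For every integer l ≥ 1, the polynomial N_{A_l} vanishes at t = 1/2 (equivalently, the linear polynomial 1 − 2t divides N_{A_l}(t)) if and only if l is even. -/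
open Polynomial

theorem Nat.cast_choose_succ_mul (n j : ℕ) :
    (n.choose (j + 1) : ℝ) * (j + 1) = n.choose j * ((n : ℝ) - j) := by
  rcases le_or_gt j n with h | h
  · rw [← Nat.cast_sub h]
    exact_mod_cast Nat.choose_succ_right_eq n j
  · simp [Nat.choose_eq_zero_of_lt h, Nat.choose_eq_zero_of_lt (h.trans j.lt_succ_self)]

/-- The `k`-th term of `N_{A_l}(1/2)`, written as `C(l+k,2k)` times a Catalan number times
`(-1/2)^k`. -/
noncomputable def halfTerm (l k : ℕ) : ℝ :=
  ((l + k).choose (2 * k) : ℝ) * (k.centralBinom / (k + 1)) * (-1 / 2) ^ k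

theorem halfTerm_eq_zero_of_lt {l k : ℕ} (h : l < k) : halfTerm l k = 0 := by
  simp [halfTerm, Nat.choose_eq_zero_of_lt (show l + k < 2 * k by lia)]

theorem eval_half_NA {l : ℕ} (hl : 1 ≤ l) :
    (NA l).eval (1 / 2 : ℝ) = ∑ k ∈ Finset.range (l + 1), halfTerm l k := by
  rw [NA, eval_finsetSum]
  refine Finset.sum_congr rfl fun k hk => ?_
  have hkl : k ≤ l := Nat.lt_succ_iff.mp (Finset.mem_range.mp hk)
  have hl0 : (l : ℝ) ≠ 0 := by positivity
  have h1 := Nat.cast_choose_succ_mul (l + k) k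
  have h2 : ((l + k).choose (2 * k) : ℝ) * k.centralBinom = (l + k).choose k * l.choose k := by
    have h := Nat.choose_mul (n := l + k) (k := 2 * k) (s := k) (by lia)
    rw [show l + k - k = l by lia, show 2 * k - k = k by lia] at h
    rw [Nat.centralBinom_eq_two_mul_choose]
    exact_mod_cast h
  have h3 : ((l + k).choose (k + 1) : ℝ) = (l + k).choose k * l / (k + 1) := by
    rw [eq_div_iff (by positivity), h1]
    push_cast
    ring
  rw [halfTerm, ← mul_div_assoc ((l + k).choose (2 * k) : ℝ), h2, h3, neg_div 2 (1 : ℝ),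
    neg_pow (1 / 2 : ℝ)]
  simp only [eval_mul, eval_C, eval_pow, eval_X]
  field_simp

theorem halfTerm_succ_telescope (l k : ℕ) :
    ((l : ℝ) + 3) * halfTerm (l + 2) (k + 1) + l * halfTerm l (k + 1) =
      (2 * l + 3) * (halfTerm (l + 1) (k + 1) - halfTerm (l + 1) k) := by
  have hb := Nat.cast_choose_succ_mul (l + k + 1) (2 * k)
  have hc := Nat.cast_choose_succ_mul (l + k + 1) (2 * k + 1)
  have hx : ((k : ℝ) + 1) * (k + 1).centralBinom = 2 * (2 * k + 1) * k.centralBinom := by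
    exact_mod_cast Nat.succ_mul_centralBinom_succ k
  rw [← eq_div_iff (by positivity)] at hb hc
  rw [mul_comm, ← eq_div_iff (by positivity)] at hx
  simp only [halfTerm]
  rw [show l + 2 + (k + 1) = l + k + 1 + 1 + 1 by ring,
    show l + 1 + (k + 1) = l + k + 1 + 1 by ring, show l + (k + 1) = l + k + 1 by ring,
    show l + 1 + k = l + k + 1 by ring, show 2 * (k + 1) = 2 * k + 1 + 1 by ring]
  simp only [Nat.choose_succ_succ' (l + k + 1 + 1), Nat.choose_succ_succ' (l + k + 1) (2 * k),
    Nat.choose_succ_succ' (l + k + 1) (2 * k + 1)]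
  push_cast at hb hc ⊢
  rw [hc, hb, hx, pow_succ]
  have h1 : (2 * (k : ℝ) + 1) ≠ 0 := by positivity
  have h2 : (2 * (k : ℝ) + 1 + 1) ≠ 0 := by positivity
  have h3 : ((k : ℝ) + 1 + 1) ≠ 0 := by positivity
  field_simp
  ring

theorem sum_halfTerm_telescope (l m : ℕ) :
    ∑ k ∈ Finset.range (m + 1), (((l : ℝ) + 3) * halfTerm (l + 2) k + l * halfTerm l k) =
      (2 * l + 3) * halfTerm (l + 1) m := by
  induction m with
  | zero =>
    simp [halfTerm]
    ring
  | succ m ih =>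
    rw [Finset.sum_range_succ, ih, halfTerm_succ_telescope]
    ring

theorem sum_halfTerm_recurrence (l : ℕ) :
    ((l : ℝ) + 3) * ∑ k ∈ Finset.range (l + 2 + 1), halfTerm (l + 2) k +
      l * ∑ k ∈ Finset.range (l + 1), halfTerm l k = 0 := by
  have h := sum_halfTerm_telescope l (l + 2)
  rw [halfTerm_eq_zero_of_lt (Nat.lt_succ_self (l + 1)), Finset.sum_add_distrib,
    ← Finset.mul_sum, ← Finset.mul_sum, Finset.sum_range_succ (halfTerm l),
    Finset.sum_range_succ (halfTerm l), halfTerm_eq_zero_of_lt (show l < l + 2 by lia),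
    halfTerm_eq_zero_of_lt (show l < l + 1 by lia)] at h
  simpa using h

theorem sum_halfTerm_eq_zero_iff (l : ℕ) (hl : 1 ≤ l) :
    ∑ k ∈ Finset.range (l + 1), halfTerm l k = 0 ↔ Even l := by
  induction l using Nat.twoStepInduction with
  | zero => lia
  | one => norm_num [Finset.sum_range_succ, halfTerm, Nat.centralBinom]
  | more l ih _ =>
    have h := sum_halfTerm_recurrence l
    have h3 : (l : ℝ) + 3 ≠ 0 := by positivity
    rcases Nat.eq_zero_or_pos l with rfl | hpos
    · simpa using h
    · have hl0 : (l : ℝ) ≠ 0 := by positivity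
      rw [Nat.even_add, ← ih hpos, iff_true_right even_two]
      constructor <;> intro h0 <;> rw [h0] at h <;> simpa [hl0, h3] using h

theorem one_sub_two_mul_X_dvd_iff (p : ℝ[X]) :
    (1 - 2 * X : ℝ[X]) ∣ p ↔ p.eval (1 / 2) = 0 := by
  have h : (1 - 2 * X : ℝ[X]) = (X - C (1 / 2)) * C (-2) := by
    rw [sub_mul, ← C_mul]
    norm_num
    rw [show (C (2 : ℝ)) = 2 from rfl]
    ring
  rw [h, IsUnit.mul_right_dvd (isUnit_C.mpr (by norm_num)), dvd_iff_isRoot, IsRoot.def]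

/-- `N_{A_l}` vanishes at `t = 1/2` (equivalently, `1 − 2t` divides `N_{A_l}`)
if and only if `l` is even. -/
theorem NA_vanishes_at_half_iff (l : ℕ) (hl : 1 ≤ l) :
    ((NA l).eval (1 / 2 : ℝ) = 0 ↔ Even l) ∧
    ((1 - 2 * X : Polynomial ℝ) ∣ NA l ↔ Even l) := by
  rw [one_sub_two_mul_X_dvd_iff, eval_half_NA hl, and_self]
  exact sum_halfTerm_eq_zero_iff l hl
end

section
/- The polynomial N_{E_8}(t) = 1 − 120t + 2135t² − 15120t³ + 54327t⁴ − 108360t⁵ + 121555t⁶ − 71760t⁷ + 17342t⁸ satisfies N_{E_8}(1) = 0 and has exactly 8 distinct real roots, all of which lie in the half-open interval (0,1]; consequently every root of N_{E_8} is real, simple, and lies in (0,1]. -/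
open Polynomial

/-- The skew-growth function of the dual Artin monoid of type `E_8`. -/
noncomputable def NE8 : Polynomial ℝ :=
  1 - 120 * X + 2135 * X ^ 2 - 15120 * X ^ 3 + 54327 * X ^ 4 - 108360 * X ^ 5 +
    121555 * X ^ 6 - 71760 * X ^ 7 + 17342 * X ^ 8

theorem NE8_eval (t : ℝ) : NE8.eval t =
    1 - 120 * t + 2135 * t ^ 2 - 15120 * t ^ 3 + 54327 * t ^ 4 - 108360 * t ^ 5 +
      121555 * t ^ 6 - 71760 * t ^ 7 + 17342 * t ^ 8 := by
  simp [NE8]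

theorem NE8_natDegree : NE8.natDegree = 8 := by
  unfold NE8
  compute_degree!

theorem NE8_ne_zero : NE8 ≠ 0 :=
  ne_zero_of_natDegree_gt (n := 0) (by simp [NE8_natDegree])

/-- A real polynomial changing sign between `a` and `b` has a root strictly between them. -/
theorem Polynomial.exists_eval_eq_zero_of_mul_neg (p : ℝ[X]) {a b : ℝ} (hab : a < b)
    (h : p.eval a * p.eval b < 0) : ∃ r, a < r ∧ r < b ∧ p.eval r = 0 := by
  have hc : ContinuousOn (fun t => p.eval t) (Set.Icc a b) := p.continuous.continuousOn
  rcases mul_neg_iff.mp h with ⟨ha, hb⟩ | ⟨ha, hb⟩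
  · obtain ⟨r, hr, h0⟩ := intermediate_value_Ioo' hab.le hc ⟨hb, ha⟩
    exact ⟨r, hr.1, hr.2, h0⟩
  · obtain ⟨r, hr, h0⟩ := intermediate_value_Ioo hab.le hc ⟨ha, hb⟩
    exact ⟨r, hr.1, hr.2, h0⟩

theorem NE8_exists_roots :
    ∃ S : Finset ℝ, S.card = 8 ∧ ∀ r ∈ S, r ∈ Set.Ioc (0 : ℝ) 1 ∧ NE8.eval r = 0 := by
  have root (a b : ℝ) := NE8.exists_eval_eq_zero_of_mul_neg (a := a) (b := b)
  obtain ⟨r₁, l₁, u₁, h₁⟩ := root 0 (1 / 20) (by norm_num) (by norm_num [NE8_eval])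
  obtain ⟨r₂, l₂, u₂, h₂⟩ := root (1 / 20) (1 / 5) (by norm_num) (by norm_num [NE8_eval])
  obtain ⟨r₃, l₃, u₃, h₃⟩ := root (1 / 5) (1 / 3) (by norm_num) (by norm_num [NE8_eval])
  obtain ⟨r₄, l₄, u₄, h₄⟩ := root (1 / 3) (1 / 2) (by norm_num) (by norm_num [NE8_eval])
  obtain ⟨r₅, l₅, u₅, h₅⟩ := root (1 / 2) (7 / 10) (by norm_num) (by norm_num [NE8_eval])
  obtain ⟨r₆, l₆, u₆, h₆⟩ := root (7 / 10) (17 / 20) (by norm_num) (by norm_num [NE8_eval])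
  obtain ⟨r₇, l₇, u₇, h₇⟩ := root (17 / 20) (19 / 20) (by norm_num) (by norm_num [NE8_eval])
  have hmono : StrictMono ![r₁, r₂, r₃, r₄, r₅, r₆, r₇, 1] := by
    rw [Fin.strictMono_iff_lt_succ]
    intro i
    fin_cases i <;> simp <;> linarith
  refine ⟨Finset.univ.map ⟨_, hmono.injective⟩, by simp, fun r hr => ?_⟩
  obtain ⟨i, -, rfl⟩ := Finset.mem_map.mp hr
  fin_cases i
  · exact ⟨⟨by simp; linarith, by simp; linarith⟩, h₁⟩
  · exact ⟨⟨by simp; linarith, by simp; linarith⟩, h₂⟩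
  · exact ⟨⟨by simp; linarith, by simp; linarith⟩, h₃⟩
  · exact ⟨⟨by simp; linarith, by simp; linarith⟩, h₄⟩
  · exact ⟨⟨by simp; linarith, by simp; linarith⟩, h₅⟩
  · exact ⟨⟨by simp; linarith, by simp; linarith⟩, h₆⟩
  · exact ⟨⟨by simp; linarith, by simp; linarith⟩, h₇⟩
  · exact ⟨⟨by simp, by simp⟩, by norm_num [NE8_eval]⟩

/-- `N_{E_8}(1) = 0` and `N_{E_8}` has exactly `8` distinct real roots, all in `(0,1]`;
every root is real, simple, and lies in `(0,1]`. -/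
theorem roots_E8 :
    NE8.eval 1 = 0 ∧
    ∃ S : Finset ℝ, S.card = 8 ∧ (∀ r ∈ S, r ∈ Set.Ioc (0 : ℝ) 1) ∧
      (∀ r : ℝ, NE8.eval r = 0 ↔ r ∈ S) ∧
      (∀ r ∈ S, Polynomial.rootMultiplicity r NE8 = 1) ∧
      (∀ z : ℂ, Polynomial.aeval z NE8 = 0 → ∃ r : ℝ, (r : ℂ) = z ∧ r ∈ Set.Ioc (0 : ℝ) 1) := by
  refine ⟨by norm_num [NE8_eval], ?_⟩
  obtain ⟨S, hcard, hS⟩ := NE8_exists_roots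
  have hroots : NE8.roots = S.val :=
    roots_eq_of_natDegree_le_card_of_ne_zero (fun r hr => (hS r hr).2)
      (by rw [NE8_natDegree, hcard]) NE8_ne_zero
  have hmem (r : ℝ) : NE8.eval r = 0 ↔ r ∈ S := by
    rw [← Finset.mem_val, ← hroots, mem_roots NE8_ne_zero, IsRoot.def]
  refine ⟨S, hcard, fun r hr => (hS r hr).1, hmem, fun r hr => ?_, fun z hz => ?_⟩
  · rw [← count_roots, hroots]
    exact Multiset.count_eq_one_of_mem S.nodup hr
  · have hsplits : NE8.Splits := by
      rw [splits_iff_card_roots, hroots, NE8_natDegree, Finset.card_val, hcard]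
    have hroot : (NE8.map (algebraMap ℝ ℂ)).IsRoot z := by
      rwa [IsRoot.def, eval_map_algebraMap]
    obtain ⟨r, rfl⟩ := hsplits.mem_range_of_isRoot NE8_ne_zero hroot
    rw [aeval_algebraMap_apply, map_eq_zero, coe_aeval_eq_eval] at hz
    exact ⟨r, rfl, (hS r ((hmem r).mp hz)).1⟩
end

section
/- For every integer L ≥ 1, the following evaluations of the (2L)-th derivatives at t = 1/2 hold: H_{4L}^{(2L)}(1/2) = (−1)^L·2^{6−6L}·(4L−2)!·(2L)!/((3L−2)!·L!); H_{4L+1}^{(2L)}(1/2) = (−1)^{L+1}·2^{2−6L}·3·(4L−1)!·(2L)!/((3L−1)!·L!); H_{4L+2}^{(2L)}(1/2) = (−1)^L·2^{1−6L}·(4L)!·(2L)!/((3L)!·L!); and H_{4L+3}^{(2L)}(1/2) = (−1)^{L+1}·2^{−2−6L}·(4L+1)!·(2L)!/((3L+1)!·L!). -/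
open Polynomial

/-- `H_l(t) = (t² − t)^{l−3}·((l−2) − (3l−4)t + (3l−4)t²)`. -/
noncomputable def Hpoly (l : ℕ) : Polynomial ℝ :=
  (X ^ 2 - X) ^ (l - 3) *
    (Polynomial.C ((l : ℝ) - 2) - Polynomial.C (3 * (l : ℝ) - 4) * X +
      Polynomial.C (3 * (l : ℝ) - 4) * X ^ 2)

theorem taylor_half_Hpoly (n : ℕ) :
    taylor (1 / 2 : ℝ) (Hpoly (n + 3)) =
      expand ℝ 2 ((X + C (-1 / 4)) ^ n * (C (3 * (n : ℝ) + 5) * X + C (((n : ℝ) - 1) / 4))) := by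
  have hbase : taylor (1 / 2 : ℝ) (X ^ 2 - X) = expand ℝ 2 (X + C (-1 / 4)) := by
    apply Polynomial.funext
    intro x
    simp [taylor_apply]
    ring
  have hfactor : taylor (1 / 2 : ℝ) (C (((n + 3 : ℕ) : ℝ) - 2) -
      C (3 * ((n + 3 : ℕ) : ℝ) - 4) * X + C (3 * ((n + 3 : ℕ) : ℝ) - 4) * X ^ 2) =
      expand ℝ 2 (C (3 * (n : ℝ) + 5) * X + C (((n : ℝ) - 1) / 4)) := by
    apply Polynomial.funext
    intro x
    simp [taylor_apply]
    ring
  rw [Hpoly, taylor_mul, taylor_pow, hbase, hfactor, map_mul, map_pow, Nat.add_sub_cancel]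

theorem eval_iterate_derivative_eq_factorial_mul_taylor_coeff (f : ℝ[X]) (r : ℝ) (k : ℕ) :
    (derivative^[k] f).eval r = (k.factorial : ℝ) * (taylor r f).coeff k := by
  rw [taylor_coeff, ← factorial_smul_hasseDeriv]
  simp

theorem choose_eq_factorial_div_real (a b : ℕ) :
    ((a + b).choose a : ℝ) = (a + b).factorial / (a.factorial * b.factorial) := by
  rw [Nat.cast_choose ℝ (Nat.le_add_right a b), Nat.add_sub_cancel_left]

theorem eval_half_iterate_derivative_Hpoly (K m : ℕ) :
    (derivative^[2 * (K + 1)] (Hpoly (K + m + 4))).eval (1 / 2 : ℝ) =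
      (-1 / 4 : ℝ) ^ m / 4 * (((K : ℝ) + m) * (m + 1) - (3 * (K + m) + 8) * (K + 1)) *
        (((K + m + 1).factorial : ℝ) * ((2 * (K + 1)).factorial : ℝ) /
          (((m + 1).factorial : ℝ) * ((K + 1).factorial : ℝ))) := by
  have hcoeff : ((X + C (-1 / 4 : ℝ)) ^ (K + m + 1) *
      (C (3 * ((K + m + 1 : ℕ) : ℝ) + 5) * X + C ((((K + m + 1 : ℕ) : ℝ) - 1) / 4))).coeff (K + 1) =
      (-1 / 4 : ℝ) ^ (m + 1) * ((K + (m + 1)).choose K : ℝ) * (3 * (K + m) + 8) +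
        (-1 / 4 : ℝ) ^ m * ((K + 1 + m).choose (K + 1) : ℝ) * ((K + m) / 4) := by
    rw [mul_add, ← mul_assoc, coeff_add, coeff_mul_X, coeff_mul_C, coeff_mul_C,
      coeff_X_add_C_pow, coeff_X_add_C_pow, show K + m + 1 - K = m + 1 by lia,
      show K + m + 1 - (K + 1) = m by lia, show K + (m + 1) = K + m + 1 by lia,
      show K + 1 + m = K + m + 1 by lia]
    push_cast
    ring
  rw [eval_iterate_derivative_eq_factorial_mul_taylor_coeff, taylor_half_Hpoly (K + m + 1),
    coeff_expand_mul' two_pos, hcoeff, choose_eq_factorial_div_real, choose_eq_factorial_div_real,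
    show K + (m + 1) = K + m + 1 by lia, show K + 1 + m = K + m + 1 by lia,
    Nat.factorial_succ m, Nat.factorial_succ K]
  have hK : (K.factorial : ℝ) ≠ 0 := by positivity
  have hm : (m.factorial : ℝ) ≠ 0 := by positivity
  push_cast
  field_simp
  ring

theorem neg_one_div_four_pow (m : ℕ) :
    (-1 / 4 : ℝ) ^ m = (-1) ^ m * (2 : ℝ) ^ (-(2 * m : ℤ)) := by
  rw [div_pow, zpow_neg, zpow_mul, div_eq_mul_inv, zpow_natCast]
  norm_num

/-- Formula A: evaluations of the `(2L)`-th derivatives of `H_{4L}, H_{4L+1}, H_{4L+2},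
`H_{4L+3}` at `t = 1/2`. -/
theorem formula_A (L : ℕ) (hL : 1 ≤ L) :
    (derivative^[2 * L] (Hpoly (4 * L))).eval (1 / 2 : ℝ) =
      (-1 : ℝ) ^ L * (2 : ℝ) ^ ((6 : ℤ) - 6 * L) *
        (((4 * L - 2).factorial : ℝ) * ((2 * L).factorial : ℝ) /
          (((3 * L - 2).factorial : ℝ) * (L.factorial : ℝ))) ∧
    (derivative^[2 * L] (Hpoly (4 * L + 1))).eval (1 / 2 : ℝ) =
      (-1 : ℝ) ^ (L + 1) * (2 : ℝ) ^ ((2 : ℤ) - 6 * L) * 3 *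
        (((4 * L - 1).factorial : ℝ) * ((2 * L).factorial : ℝ) /
          (((3 * L - 1).factorial : ℝ) * (L.factorial : ℝ))) ∧
    (derivative^[2 * L] (Hpoly (4 * L + 2))).eval (1 / 2 : ℝ) =
      (-1 : ℝ) ^ L * (2 : ℝ) ^ ((1 : ℤ) - 6 * L) *
        (((4 * L).factorial : ℝ) * ((2 * L).factorial : ℝ) /
          (((3 * L).factorial : ℝ) * (L.factorial : ℝ))) ∧
    (derivative^[2 * L] (Hpoly (4 * L + 3))).eval (1 / 2 : ℝ) =
      (-1 : ℝ) ^ (L + 1) * (2 : ℝ) ^ ((-2 : ℤ) - 6 * L) *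
        (((4 * L + 1).factorial : ℝ) * ((2 * L).factorial : ℝ) /
          (((3 * L + 1).factorial : ℝ) * (L.factorial : ℝ))) := by
  obtain ⟨K, rfl⟩ : ∃ K, L = K + 1 := ⟨L - 1, by lia⟩
  have two_zpow (a b : ℤ) : (2 : ℝ) ^ (a + b) = 2 ^ a * 2 ^ b := zpow_add₀ two_ne_zero a b
  have hsign : (-1 : ℝ) ^ (3 * K) = (-1) ^ K := by
    rw [pow_mul]; norm_num
  refine ⟨?_, ?_, ?_, ?_⟩
  · have h := eval_half_iterate_derivative_Hpoly K (3 * K)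
    rw [show K + 3 * K + 4 = 4 * (K + 1) by lia, neg_one_div_four_pow, hsign] at h
    rw [h, show 4 * (K + 1) - 2 = K + 3 * K + 1 + 1 by lia,
      show 3 * (K + 1) - 2 = 3 * K + 1 by lia, Nat.factorial_succ (K + 3 * K + 1),
      show (6 : ℤ) - 6 * ((K + 1 : ℕ) : ℤ) = -(2 * ((3 * K : ℕ) : ℤ)) by push_cast; ring]
    push_cast
    ring
  · have h := eval_half_iterate_derivative_Hpoly K (3 * K + 1)
    rw [show K + (3 * K + 1) + 4 = 4 * (K + 1) + 1 by lia, neg_one_div_four_pow, pow_succ,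
      hsign] at h
    rw [h, show 4 * (K + 1) - 1 = K + (3 * K + 1) + 1 + 1 by lia,
      show 3 * (K + 1) - 1 = 3 * K + 1 + 1 by lia, Nat.factorial_succ (K + (3 * K + 1) + 1),
      show (2 : ℤ) - 6 * ((K + 1 : ℕ) : ℤ) = -(2 * ((3 * K + 1 : ℕ) : ℤ)) + (-2) by
        push_cast; ring, two_zpow]
    push_cast
    norm_num
    ring
  · have h := eval_half_iterate_derivative_Hpoly K (3 * K + 2)
    rw [show K + (3 * K + 2) + 4 = 4 * (K + 1) + 2 by lia, neg_one_div_four_pow, pow_add,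
      hsign] at h
    rw [h, show 4 * (K + 1) = K + (3 * K + 2) + 1 + 1 by lia,
      show 3 * (K + 1) = 3 * K + 2 + 1 by lia, Nat.factorial_succ (K + (3 * K + 2) + 1),
      show (1 : ℤ) - 6 * ((K + 1 : ℕ) : ℤ) = -(2 * ((3 * K + 2 : ℕ) : ℤ)) + (-1) by
        push_cast; ring, two_zpow]
    push_cast
    norm_num
    ring
  · have h := eval_half_iterate_derivative_Hpoly K (3 * K + 3)
    rw [show K + (3 * K + 3) + 4 = 4 * (K + 1) + 3 by lia, neg_one_div_four_pow, pow_add,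
      hsign] at h
    rw [h, show 4 * (K + 1) + 1 = K + (3 * K + 3) + 1 + 1 by lia,
      show 3 * (K + 1) + 1 = 3 * K + 3 + 1 by lia, Nat.factorial_succ (K + (3 * K + 3) + 1),
      show (-2 : ℤ) - 6 * ((K + 1 : ℕ) : ℤ) = -(2 * ((3 * K + 3 : ℕ) : ℤ)) + (-2) by
        push_cast; ring, two_zpow]
    push_cast
    norm_num
    ring
end

section
/- For every integer k ≥ 1, let h_k(t) = (t(t−1))^k and let h_k^{(i)} denote its i-th derivative. Then h_k^{(2i−1)}(1/2) = 0 for every integer i with 1 ≤ i ≤ ⌊(k+1)/2⌋, and h_k^{(2i)}(1/2) = (−1/4)^{k−i}·k!·(2i)!/((k−i)!·i!) for every integer i with 1 ≤ i ≤ ⌊k/2⌋. -/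
open Polynomial

/-- `h_k(t) = (t(t−1))^k`. -/
noncomputable def hpoly (k : ℕ) : Polynomial ℝ := (X * (X - 1)) ^ k

/-- Recentred at `1/2`, `h_k` becomes the even polynomial `(X² - 1/4)^k`. -/
theorem taylor_half_hpoly (k : ℕ) :
    taylor (1 / 2 : ℝ) (hpoly k) = expand ℝ 2 ((X + C (-(1 / 4))) ^ k) := by
  have h : (X + C (1 / 2 : ℝ)) * (X + C (1 / 2) - 1) = X ^ 2 + C (-(1 / 4)) := by
    have h₁ : (1 : ℝ[X]) = C (1 / 2) + C (1 / 2) := by rw [← C_add]; norm_num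
    have h₂ : C (-(1 / 4) : ℝ) = -(C (1 / 2) * C (1 / 2)) := by
      rw [← C_mul, ← C_neg]; norm_num
    rw [h₁, h₂]
    ring
  rw [hpoly, taylor_apply, pow_comp, mul_comp, sub_comp, X_comp, one_comp, h]
  simp

/-- Derivatives at a point are the factorial multiples of the Taylor coefficients there. -/
theorem eval_iterate_derivative_eq_taylor_coeff (p : ℝ[X]) (n : ℕ) (r : ℝ) :
    (derivative^[n] p).eval r = n.factorial * (taylor r p).coeff n := by
  rw [taylor_coeff, ← factorial_smul_hasseDeriv]
  simp

/-- Formula B: `h_k^{(2i−1)}(1/2) = 0` for `1 ≤ i ≤ ⌊(k+1)/2⌋` and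
`h_k^{(2i)}(1/2) = (−1/4)^{k−i}·k!·(2i)!/((k−i)!·i!)` for `1 ≤ i ≤ ⌊k/2⌋`. -/
theorem formula_B (k : ℕ) (hk : 1 ≤ k) :
    (∀ i : ℕ, 1 ≤ i → i ≤ (k + 1) / 2 →
      (derivative^[2 * i - 1] (hpoly k)).eval (1 / 2 : ℝ) = 0) ∧
    (∀ i : ℕ, 1 ≤ i → i ≤ k / 2 →
      (derivative^[2 * i] (hpoly k)).eval (1 / 2 : ℝ) =
        (-(1 / 4) : ℝ) ^ (k - i) *
          ((k.factorial : ℝ) * ((2 * i).factorial : ℝ) /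
            (((k - i).factorial : ℝ) * (i.factorial : ℝ)))) := by
  simp only [eval_iterate_derivative_eq_taylor_coeff, taylor_half_hpoly]
  refine ⟨fun i hi _ => ?_, fun i _ hik => ?_⟩
  · rw [coeff_expand two_pos, if_neg (by omega), mul_zero]
  · rw [coeff_expand_mul' two_pos, coeff_X_add_C_pow, Nat.cast_choose ℝ (by omega : i ≤ k)]
    ring
end

section
/- For every integer l ≥ 1, the identity N_{A_l}(t) + t·N_{A_l}′(t) = (−1)^l·P̃_l(t) holds as an identity of real polynomials in t; equivalently, the derivative of t·N_{A_l}(t) equals (−1)^l times the shifted Legendre polynomial P̃_l(t). -/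
open Polynomial

/-- The shifted Legendre polynomial
`P̃_l(t) = (−1)^l ∑_{k=0}^{l} (−1)^k ((l+k)!/((l−k)!·(k!)²))·t^k`. -/
noncomputable def Pleg (l : ℕ) : Polynomial ℝ :=
  Polynomial.C ((-1 : ℝ) ^ l) *
    ∑ k ∈ Finset.range (l + 1),
      Polynomial.C ((-1 : ℝ) ^ k * ((l + k).factorial : ℝ) /
        (((l - k).factorial : ℝ) * ((k.factorial : ℝ)) ^ 2)) * X ^ k

theorem succ_mul_NA_coeff {l k : ℕ} (hl : 1 ≤ l) (hk : k ≤ l) :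
    ((k : ℝ) + 1) * ((1 / (l : ℝ)) * (l.choose k : ℝ) * ((l + k).choose (k + 1) : ℝ)) =
      ((l + k).factorial : ℝ) / (((l - k).factorial : ℝ) * (k.factorial : ℝ) ^ 2) := by
  obtain ⟨m, rfl⟩ : ∃ m, l = m + 1 := ⟨l - 1, by omega⟩
  rw [Nat.cast_choose ℝ hk, Nat.cast_choose ℝ (show k + 1 ≤ m + 1 + k by omega),
    show m + 1 + k - (k + 1) = m by omega, Nat.factorial_succ m, Nat.factorial_succ k]
  have := Nat.factorial_pos m
  have := Nat.factorial_pos k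
  have := Nat.factorial_pos (m + 1 - k)
  push_cast
  field_simp

/-- `N_{A_l}(t) + t·N_{A_l}′(t) = (−1)^l·P̃_l(t)`, i.e. the derivative of `t·N_{A_l}(t)`
equals `(−1)^l` times the shifted Legendre polynomial. -/
theorem NA_Legendre (l : ℕ) (hl : 1 ≤ l) :
    NA l + X * derivative (NA l) = Polynomial.C ((-1 : ℝ) ^ l) * Pleg l ∧
    derivative (X * NA l) = Polynomial.C ((-1 : ℝ) ^ l) * Pleg l := by
  have key : NA l + X * derivative (NA l) = Polynomial.C ((-1 : ℝ) ^ l) * Pleg l := by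
    rw [Pleg, ← mul_assoc, ← C_mul, ← mul_pow, neg_one_mul, neg_neg, one_pow, C_1, one_mul, NA,
      derivative_sum, Finset.mul_sum, ← Finset.sum_add_distrib]
    refine Finset.sum_congr rfl fun k hk => ?_
    rw [mul_div_assoc, ← succ_mul_NA_coeff hl (Finset.mem_range_succ_iff.mp hk)]
    cases k with
    | zero => simp
    | succ k =>
      rw [derivative_C_mul_X_pow, Nat.add_sub_cancel]
      simp only [map_mul, map_add, map_natCast, map_one]
      ring
  refine ⟨key, ?_⟩
  rw [← key, derivative_mul, derivative_X, one_mul]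
end

section
/- For every integer l ≥ 2, the identity N_{B_l}(t) + (t/l)·N_{B_l}′(t) = (−1)^l·P̃_l(t) holds as an identity of real polynomials in t, where N_{B_l}′ denotes the derivative of N_{B_l}. -/
open Polynomial

theorem choose_mul_choose_mul_one_add_div {l k : ℕ} (hl : l ≠ 0) (hk : k ≤ l) :
    (l.choose k : ℝ) * ((l + k - 1).choose k : ℝ) * (1 + k / l) =
      ((l + k).factorial : ℝ) / (((l - k).factorial : ℝ) * (k.factorial : ℝ) ^ 2) := by
  obtain ⟨n, rfl⟩ := Nat.exists_eq_succ_of_ne_zero hl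
  have hsub : n.succ + k - 1 = n + k := by omega
  have hfac : (n.succ + k).factorial = (n + k + 1) * (n + k).factorial := by
    rw [Nat.succ_add, Nat.factorial_succ]
  rw [hsub, hfac, Nat.cast_choose ℝ hk, Nat.cast_choose ℝ (Nat.le_add_left k n),
    Nat.add_sub_cancel, Nat.factorial_succ]
  have hn : (n : ℝ) + 1 ≠ 0 := by positivity
  have := Nat.cast_ne_zero (R := ℝ).mpr (n.succ - k).factorial_ne_zero
  have := Nat.cast_ne_zero (R := ℝ).mpr n.factorial_ne_zero
  have := Nat.cast_ne_zero (R := ℝ).mpr k.factorial_ne_zero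
  simp only [Nat.succ_eq_add_one, Nat.cast_mul, Nat.cast_add, Nat.cast_one] at *
  field_simp
  ring

theorem X_mul_derivative_C_mul_X_pow {R : Type*} [CommSemiring R] (a : R) (k : ℕ) :
    X * derivative (C a * X ^ k) = C (a * k) * X ^ k := by
  rw [derivative_C_mul_X_pow]
  cases k with
  | zero => simp
  | succ n => rw [Nat.add_sub_cancel, pow_succ]; ring

/-- `N_{B_l}(t) + (t/l)·N_{B_l}′(t) = (−1)^l·P̃_l(t)`. -/
theorem NB_Legendre (l : ℕ) (hl : 2 ≤ l) :
    NB l + Polynomial.C (1 / (l : ℝ)) * X * derivative (NB l) =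
      Polynomial.C ((-1 : ℝ) ^ l) * Pleg l := by
  rw [Pleg, ← mul_assoc, ← C_mul, ← mul_pow, neg_one_mul, neg_neg, one_pow, C_1, one_mul, NB,
    derivative_sum, Finset.mul_sum, ← Finset.sum_add_distrib]
  refine Finset.sum_congr rfl fun k hk => ?_
  rw [mul_assoc (C (1 / (l : ℝ))), X_mul_derivative_C_mul_X_pow, ← mul_assoc, ← C_mul,
    ← add_mul, ← C_add,
    mul_div_assoc, ← choose_mul_choose_mul_one_add_div (by omega)
      (Nat.lt_succ_iff.mp (Finset.mem_range.mp hk))]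
  congr 2
  ring
end

section
/- For every integer l ≥ 1, let 1 = t_1 > t_2 > ⋯ > t_l > 0 be the l distinct real roots of N_{A_l} listed in decreasing order, and let x̃_1 > x̃_2 > ⋯ > x̃_l be the l distinct real roots of the shifted Legendre polynomial P̃_l listed in decreasing order (all of which lie in (0,1)). Then the roots strictly interlace: t_ν > x̃_ν > t_{ν+1} for every ν with 1 ≤ ν ≤ l−1, and t_l > x̃_l > 0. -/
open Polynomial

/-- The polynomial `t · N_{A_l}(t)` is, up to sign, an antiderivative of the shifted Legendre
polynomial. -/
theorem derivative_X_mul_NA {l : ℕ} (hl : 1 ≤ l) :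
    derivative (X * NA l) = C ((-1 : ℝ) ^ l) * Pleg l := by
  have hsign : (C ((-1 : ℝ) ^ l) * C ((-1 : ℝ) ^ l) : ℝ[X]) = 1 := by
    rw [← C_mul, ← mul_pow]
    simp
  rw [Pleg, ← mul_assoc, hsign, one_mul, NA, Finset.mul_sum, derivative_sum]
  refine Finset.sum_congr rfl fun k hk => ?_
  have hkl : k ≤ l := Nat.lt_succ_iff.mp (Finset.mem_range.mp hk)
  rw [X_mul, mul_assoc, ← pow_succ, derivative_C_mul_X_pow, Nat.add_sub_cancel]
  congr 2
  obtain ⟨m, rfl⟩ : ∃ m, l = m + 1 := ⟨l - 1, by omega⟩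
  have h₁ := Nat.cast_choose ℝ hkl
  have h₂ := Nat.cast_choose ℝ (show k + 1 ≤ m + 1 + k by omega)
  rw [show m + 1 + k - (k + 1) = m by omega] at h₂
  rw [h₁, h₂, Nat.factorial_succ m, Nat.factorial_succ k]
  have := Nat.factorial_ne_zero m
  have := Nat.factorial_ne_zero k
  have := Nat.factorial_ne_zero (m + 1 - k)
  push_cast
  field_simp

/-- Rolle's theorem for `t · N_{A_l}(t)`: two of its roots enclose a root of the shifted Legendre
polynomial. -/
theorem exists_Pleg_root_between {l : ℕ} (hl : 1 ≤ l) {a b : ℝ} (hab : a < b)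
    (ha : (X * NA l).eval a = 0) (hb : (X * NA l).eval b = 0) :
    ∃ y ∈ Set.Ioo a b, (Pleg l).eval y = 0 := by
  obtain ⟨y, hy, hy'⟩ := exists_deriv_eq_zero hab (X * NA l).continuous.continuousOn
    (ha.trans hb.symm)
  refine ⟨y, hy, ?_⟩
  rw [Polynomial.deriv, derivative_X_mul_NA hl, eval_mul, eval_C] at hy'
  exact (mul_eq_zero.mp hy').resolve_left (pow_ne_zero _ (by norm_num))

/-- Interlacing of the roots of `N_{A_l}` with the roots of the shifted Legendre
polynomial `P̃_l`: if `1 = t_1 > ⋯ > t_l > 0` are the roots of `N_{A_l}` and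
`x̃_1 > ⋯ > x̃_l` the roots of `P̃_l`, then `t_ν > x̃_ν > t_{ν+1}` for `1 ≤ ν ≤ l−1`
and `t_l > x̃_l > 0`. -/
theorem interlacing_A (l : ℕ) (hl : 1 ≤ l) (t x : Fin l → ℝ)
    (htanti : StrictAnti t)
    (htroot : ∀ i, (NA l).eval (t i) = 0)
    (htall : ∀ y : ℝ, (NA l).eval y = 0 → ∃ i, t i = y)
    (ht1 : t ⟨0, hl⟩ = 1) (htpos : ∀ i, 0 < t i)
    (hxanti : StrictAnti x)
    (hxroot : ∀ i, (Pleg l).eval (x i) = 0)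
    (hxall : ∀ y : ℝ, (Pleg l).eval y = 0 → ∃ i, x i = y) :
    (∀ i : Fin l, x i < t i) ∧
    (∀ i j : Fin l, (j : ℕ) = (i : ℕ) + 1 → t j < x i) ∧
    0 < x ⟨l - 1, by omega⟩ := by
  let s : Fin l → ℝ := fun i => if h : (i : ℕ) + 1 < l then t ⟨i + 1, h⟩ else 0
  have hs : ∀ i j : Fin l, (j : ℕ) = (i : ℕ) + 1 → s i = t j := by
    intro i j hij
    have h : (i : ℕ) + 1 < l := hij ▸ j.isLt
    simp only [s, dif_pos h]
    exact congrArg t (Fin.ext hij.symm)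
  have hs_nonneg : ∀ i, 0 ≤ s i := by
    intro i
    by_cases h : (i : ℕ) + 1 < l
    · exact hs i ⟨i + 1, h⟩ rfl ▸ (htpos _).le
    · simp [s, h]
  have hst : ∀ i, s i < t i := by
    intro i
    by_cases h : (i : ℕ) + 1 < l
    · rw [hs i ⟨i + 1, h⟩ rfl]
      exact htanti (Fin.lt_def.mpr (Nat.lt_succ_self _))
    · simpa [s, h] using htpos i
  have hs_root : ∀ i, (X * NA l).eval (s i) = 0 := by
    intro i
    by_cases h : (i : ℕ) + 1 < l
    · simp [hs i ⟨i + 1, h⟩ rfl, htroot]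
    · simp [s, h]
  have hts : ∀ i j : Fin l, i < j → t j ≤ s i := by
    intro i j hij
    have h : (i : ℕ) + 1 < l := by omega
    rw [hs i ⟨i + 1, h⟩ rfl]
    exact htanti.antitone (Fin.le_def.mpr (by simpa using hij))
  have hroot : ∀ i, ∃ j, x j ∈ Set.Ioo (s i) (t i) := by
    intro i
    obtain ⟨y, hy, hy0⟩ := exists_Pleg_root_between hl (hst i) (hs_root i) (by simp [htroot])
    obtain ⟨j, rfl⟩ := hxall y hy0
    exact ⟨j, hy⟩
  choose f hf using hroot
  have hf_mono : StrictMono f := fun i j hij =>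
    hxanti.lt_iff_gt.mp (((hf j).2.trans_le (hts i j hij)).trans (hf i).1)
  have hf_id : f = id := (StrictMono.range_inj hf_mono strictMono_id).mp <| by
    rw [(Finite.surjective_of_injective hf_mono.injective).range_eq, Set.range_id]
  simp only [hf_id, id] at hf
  exact ⟨fun i => (hf i).2, fun i j hij => hs i j hij ▸ (hf i).1,
    (hs_nonneg _).trans_lt (hf _).1⟩
end

section
/- For each integer l ≥ 2, let s_l denote the smallest real root of the polynomial N_{B_l} (which exists and lies in the interval (0,1]). Then the sequence (s_l)_{l≥2} is strictly decreasing, i.e. s_{l+1} < s_l for all l ≥ 2, and s_l converges to 0 as l tends to infinity. -/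
open Polynomial

/-- The product `∏_{j<k} (j² - x²)`, which is `(-x)_k (x)_k` in terms of rising factorials. -/
noncomputable def prodSqSub (x : ℝ) (k : ℕ) : ℝ :=
  ∏ j ∈ Finset.range k, ((j : ℝ) ^ 2 - x ^ 2)

lemma prodSqSub_succ (x : ℝ) (k : ℕ) :
    prodSqSub x (k + 1) = prodSqSub x k * ((k : ℝ) ^ 2 - x ^ 2) :=
  Finset.prod_range_succ _ _

lemma prodSqSub_neg (x : ℝ) (k : ℕ) : prodSqSub (-x) k = prodSqSub x k := by
  simp [prodSqSub]

lemma mul_prodSqSub_add_one (x : ℝ) (k : ℕ) :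
    x * prodSqSub (x + 1) (k + 1) = -((x + 1) * (x + k) * (x + k + 1)) * prodSqSub x k := by
  induction k with
  | zero => simp [prodSqSub]; ring
  | succ k ih =>
    rw [prodSqSub_succ (x + 1) (k + 1), prodSqSub_succ x k]
    push_cast
    linear_combination (((k : ℝ) + 1) ^ 2 - (x + 1) ^ 2) * ih

lemma mul_prodSqSub_sub_one (x : ℝ) (k : ℕ) :
    x * prodSqSub (x - 1) (k + 1) = -((x - 1) * (x - k) * (x - k - 1)) * prodSqSub x k := by
  have h := mul_prodSqSub_add_one (-x) k
  rw [show -x + 1 = -(x - 1) by ring, prodSqSub_neg, prodSqSub_neg] at h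
  linear_combination -h

lemma prodSqSub_eq_zero {l k : ℕ} (h : l < k) : prodSqSub l k = 0 :=
  Finset.prod_eq_zero (Finset.mem_range.2 h) (sub_self _)

lemma neg_one_pow_mul_choose_mul_choose (l k : ℕ) (hk : k ≤ l) :
    (-1 : ℝ) ^ k * (l.choose k : ℝ) * ((l + k - 1).choose k : ℝ) =
      prodSqSub l k / (k.factorial : ℝ) ^ 2 := by
  have hf : (k.factorial : ℝ) ≠ 0 := by positivity
  rw [eq_div_iff (pow_ne_zero 2 hf)]
  have key : (-1 : ℝ) ^ k * (l.descFactorial k : ℝ) * (l.ascFactorial k : ℝ) = prodSqSub l k := by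
    clear hf
    induction k with
    | zero => simp [prodSqSub]
    | succ k ih =>
      rw [prodSqSub_succ, ← ih (by omega), Nat.descFactorial_succ, Nat.ascFactorial_succ, pow_succ]
      push_cast [Nat.cast_sub (show k ≤ l by omega)]
      ring
  rw [← key, Nat.descFactorial_eq_factorial_mul_choose, Nat.ascFactorial_eq_factorial_mul_choose']
  push_cast
  ring

lemma eval_NB_eq_sum (l M : ℕ) (hM : l < M) (t : ℝ) :
    (NB l).eval t =
      ∑ k ∈ Finset.range M, prodSqSub l k / (k.factorial : ℝ) ^ 2 * t ^ k := by
  have h : Finset.range (l + 1) ⊆ Finset.range M := Finset.range_subset_range.2 hM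
  rw [← Finset.sum_subset h, NB, eval_finsetSum]
  · refine Finset.sum_congr rfl fun k hk => ?_
    rw [neg_one_pow_mul_choose_mul_choose l k (Nat.lt_succ_iff.1 (Finset.mem_range.1 hk))]
    simp
  · intro k _ hk
    rw [prodSqSub_eq_zero (by simpa using hk)]
    simp

/-- The three-term recurrence of the polynomials `N_{B_l}`. -/
lemma eval_NB_recurrence (l : ℕ) (t : ℝ) :
    ((l : ℝ) + 2) * (2 * l + 1) * (NB (l + 2)).eval t =
      ((2 * l + 1) * (2 * l + 3) * (1 - 2 * t) - 1) * (NB (l + 1)).eval t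
        - l * (2 * l + 3) * (NB l).eval t := by
  rw [eval_NB_eq_sum l (l + 3) (by omega), eval_NB_eq_sum (l + 2) (l + 3) (by omega)]
  have h1 := eval_NB_eq_sum (l + 1) (l + 2) (by omega) t
  have h2 := eval_NB_eq_sum (l + 1) (l + 3) (by omega) t
  have hsum : ((l : ℝ) + 2) * (2 * l + 1) *
        ∑ k ∈ Finset.range (l + 3), prodSqSub (l + 2 : ℕ) k / (k.factorial : ℝ) ^ 2 * t ^ k =
      ((2 * l + 1) * (2 * l + 3) - 1) *
        ∑ k ∈ Finset.range (l + 3), prodSqSub (l + 1 : ℕ) k / (k.factorial : ℝ) ^ 2 * t ^ k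
      - 2 * t * (2 * l + 1) * (2 * l + 3) *
        ∑ k ∈ Finset.range (l + 2), prodSqSub (l + 1 : ℕ) k / (k.factorial : ℝ) ^ 2 * t ^ k
      - l * (2 * l + 3) *
        ∑ k ∈ Finset.range (l + 3), prodSqSub l k / (k.factorial : ℝ) ^ 2 * t ^ k := by
    simp only [Finset.sum_range_succ' _ (l + 2)]
    have hterm : ∀ k : ℕ, ((l : ℝ) + 2) * (2 * l + 1) *
          (prodSqSub (l + 2 : ℕ) (k + 1) / ((k + 1).factorial : ℝ) ^ 2 * t ^ (k + 1)) =
        ((2 * l + 1) * (2 * l + 3) - 1) *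
          (prodSqSub (l + 1 : ℕ) (k + 1) / ((k + 1).factorial : ℝ) ^ 2 * t ^ (k + 1))
        - 2 * t * (2 * l + 1) * (2 * l + 3) *
          (prodSqSub (l + 1 : ℕ) k / (k.factorial : ℝ) ^ 2 * t ^ k)
        - l * (2 * l + 3) *
          (prodSqSub l (k + 1) / ((k + 1).factorial : ℝ) ^ 2 * t ^ (k + 1)) := by
      intro k
      have hx : ((l : ℝ) + 1) ≠ 0 := by positivity
      have ha := mul_prodSqSub_add_one ((l : ℝ) + 1) k
      have hb := mul_prodSqSub_sub_one ((l : ℝ) + 1) k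
      have hc := prodSqSub_succ ((l : ℝ) + 1) k
      rw [add_sub_cancel_right] at hb
      rw [show (l : ℝ) + 1 + 1 = l + 2 by ring] at ha
      push_cast [Nat.factorial_succ]
      have hf : (k.factorial : ℝ) ≠ 0 := by positivity
      have hk : (k : ℝ) + 1 ≠ 0 := by positivity
      have hcoef : ((l : ℝ) + 2) * (2 * l + 1) * prodSqSub (l + 2) (k + 1) =
          ((2 * l + 1) * (2 * l + 3) - 1) * prodSqSub (l + 1) (k + 1)
          - 2 * (2 * l + 1) * (2 * l + 3) * ((k : ℝ) + 1) ^ 2 * prodSqSub (l + 1) k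
          - l * (2 * l + 3) * prodSqSub l (k + 1) := by
        apply mul_left_cancel₀ hx
        rw [hc]
        linear_combination ((l : ℝ) + 2) * (2 * l + 1) * ha + l * (2 * l + 3) * hb
      field_simp
      linear_combination t * t ^ k * hcoef
    have hS := Finset.sum_congr (rfl : Finset.range (l + 2) = _) fun k _ => hterm k
    simp only [Finset.sum_sub_distrib, ← Finset.mul_sum] at hS
    rw [mul_add, hS]
    simp only [prodSqSub, Finset.range_zero, Finset.prod_empty, Nat.factorial_zero, Nat.cast_one,
      pow_zero]
    ring
  rw [hsum, ← h1, ← h2]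
  ring

lemma eval_NB_pos_of_nonpos (l : ℕ) {t : ℝ} (ht : t ≤ 0) : 0 < (NB l).eval t := by
  rw [NB, eval_finsetSum, Finset.sum_range_succ']
  refine add_pos_of_nonneg_of_pos (Finset.sum_nonneg fun k _ => ?_) (by simp)
  have h : 0 ≤ (-t) ^ (k + 1) := pow_nonneg (neg_nonneg.2 ht) _
  rw [neg_pow] at h
  rw [eval_mul, eval_C, eval_pow, eval_X]
  have := mul_nonneg (mul_nonneg (Nat.cast_nonneg (α := ℝ) (l.choose (k + 1)))
    (Nat.cast_nonneg (α := ℝ) ((l + (k + 1) - 1).choose (k + 1)))) h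
  linarith

lemma eval_NB_one (t : ℝ) : (NB 1).eval t = 1 - t := by
  simp [NB, Finset.sum_range_succ]
  ring

lemma eval_NB_two (t : ℝ) : (NB 2).eval t = (1 - t) * (1 - 3 * t) := by
  simp [NB, Finset.sum_range_succ, Nat.choose]
  ring

lemma exists_eval_NB_eq_zero (l : ℕ) {t : ℝ} (ht : 0 ≤ t) (h : (NB l).eval t ≤ 0) :
    ∃ y ≤ t, (NB l).eval y = 0 := by
  obtain ⟨y, hy, hy0⟩ := intermediate_value_Icc' ht (NB l).continuous.continuousOn
    ⟨h, (eval_NB_pos_of_nonpos l le_rfl).le⟩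
  exact ⟨y, hy.2, hy0⟩

/-- As long as the values `N_{B_k}(t)` stay nonnegative, they decay at a definite rate. -/
lemma eval_NB_succ_le {t : ℝ} (ht : 0 ≤ t) (l : ℕ)
    (h : ∀ k, 1 ≤ k → k ≤ l + 1 → 0 ≤ (NB k).eval t) :
    (NB (l + 2)).eval t ≤ (1 - (2 * l + 3) * t) * (NB (l + 1)).eval t := by
  induction l with
  | zero =>
    have h1 := h 1 le_rfl le_rfl
    simp only [zero_add, eval_NB_one, eval_NB_two] at h1 ⊢
    push_cast
    linarith
  | succ l ih =>
    have ih' := ih fun k h1 h2 => h k h1 (by omega)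
    have hrec := eval_NB_recurrence (l + 1) t
    have hp := h (l + 1) (by omega) (by omega)
    have hq := h (l + 2) (by omega) (by omega)
    rw [show l + 1 + 2 = l + 3 by ring, show l + 1 + 1 = l + 2 by ring] at *
    push_cast at hrec ⊢
    set p := (NB (l + 1)).eval t
    set q := (NB (l + 2)).eval t
    set r := (NB (l + 3)).eval t
    have hl : (0 : ℝ) ≤ l := Nat.cast_nonneg l
    have hqp : q ≤ p := by
      nlinarith [mul_nonneg (mul_nonneg (by linarith : 0 ≤ 2 * (l : ℝ) + 3) ht) hp]
    have hstep : (2 * (l : ℝ) + 3) * t * q ≤ p - q := by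
      nlinarith [mul_le_mul_of_nonneg_left hqp
        (mul_nonneg (by linarith : 0 ≤ 2 * (l : ℝ) + 3) ht)]
    have hpos : 0 < ((l : ℝ) + 3) * (2 * l + 3) := by positivity
    refine le_of_mul_le_mul_left ?_ hpos
    have := mul_le_mul_of_nonneg_left hstep
      (by positivity : 0 ≤ ((l : ℝ) + 1) * (2 * l + 5))
    linarith

/-- If `s l` denotes the smallest real root of `N_{B_l}` (which lies in `(0,1]`),
then the sequence `(s_l)_{l ≥ 2}` is strictly decreasing and converges to `0`. -/
theorem smallest_root_B (s : ℕ → ℝ)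
    (hroot : ∀ l, 2 ≤ l → (NB l).eval (s l) = 0)
    (hmin : ∀ l, 2 ≤ l → ∀ y : ℝ, (NB l).eval y = 0 → s l ≤ y) :
    (∀ l, 2 ≤ l → s (l + 1) < s l) ∧
    Filter.Tendsto s Filter.atTop (nhds 0) := by
  have hspos : ∀ l, 2 ≤ l → 0 < s l := fun l hl => by
    by_contra! h
    exact (eval_NB_pos_of_nonpos l h).ne' (hroot l hl)
  have hpos : ∀ l, 2 ≤ l → ∀ t, 0 ≤ t → t < s l → 0 < (NB l).eval t := by
    intro l hl t ht hts
    by_contra! h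
    obtain ⟨y, hyt, hy⟩ := exists_eval_NB_eq_zero l ht h
    linarith [hmin l hl y hy]
  have hlt : ∀ l, 2 ≤ l → ∀ t, 0 ≤ t → (NB l).eval t < 0 → s l < t := by
    intro l hl t ht h
    obtain ⟨y, hyt, hy⟩ := exists_eval_NB_eq_zero l ht h.le
    refine (hmin l hl y hy).trans_lt (hyt.lt_of_ne ?_)
    rintro rfl
    exact h.ne hy
  have hs2 : s 2 ≤ 1 / 3 := hmin 2 le_rfl _ (by rw [eval_NB_two]; norm_num)
  have hstep : ∀ l, 1 ≤ l → 0 < (NB l).eval (s (l + 1)) → s (l + 2) < s (l + 1) := by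
    intro l hl h
    refine hlt (l + 2) (by omega) _ (hspos _ (by omega)).le ?_
    have hrec := eval_NB_recurrence l (s (l + 1))
    rw [hroot (l + 1) (by omega)] at hrec
    have hl' : (0 : ℝ) < l := by exact_mod_cast hl
    have : 0 < l * (2 * l + 3) * (NB l).eval (s (l + 1)) := by positivity
    have hc : 0 < ((l : ℝ) + 2) * (2 * l + 1) := by positivity
    by_contra! hneg
    linarith [mul_nonneg hc.le hneg]
  have hanti : ∀ l, 2 ≤ l → s (l + 1) < s l := by
    intro l hl
    induction l, hl using Nat.le_induction with
    | base => exact hstep 1 le_rfl (by rw [eval_NB_one]; norm_num; linarith)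
    | succ l hl ih =>
      exact hstep l (by omega) (hpos l hl _ (hspos (l + 1) (by omega)).le ih)
  refine ⟨hanti, ?_⟩
  have hle : ∀ k l, 2 ≤ k → k ≤ l → s l ≤ s k := by
    intro k l hk hkl
    induction l, hkl using Nat.le_induction with
    | base => exact le_rfl
    | succ l hl ih => exact (hanti l (by omega)).le.trans ih
  have hbound : ∀ l : ℕ, s (l + 2) ≤ 1 / ((l : ℝ) + 1) := by
    intro l
    by_contra! h
    have ht : 0 < 1 / ((l : ℝ) + 1) := by positivity
    set t := 1 / ((l : ℝ) + 1) with htdef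
    have hk : ∀ k, 1 ≤ k → k ≤ l + 2 → 0 < (NB k).eval t := by
      intro k hk1 hk2
      obtain rfl | hk1 := hk1.eq_or_lt
      · rw [eval_NB_one]
        linarith [hle 2 (l + 2) le_rfl (by omega)]
      · exact hpos k hk1 t ht.le (h.trans_le (hle k (l + 2) hk1 hk2))
    have hdecay := eval_NB_succ_le ht.le l fun k h1 h2 => (hk k h1 (by omega)).le
    have hone : ((l : ℝ) + 1) * t = 1 := by rw [htdef]; field_simp
    have hneg : 1 - (2 * (l : ℝ) + 3) * t ≤ 0 := by linarith
    linarith [mul_nonneg (neg_nonneg.2 hneg) (hk (l + 1) (by omega) (by omega)).le,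
      hk (l + 2) (by omega) le_rfl]
  rw [← Filter.tendsto_add_atTop_iff_nat 2]
  exact squeeze_zero (fun l => (hspos (l + 2) (by omega)).le) hbound
    tendsto_one_div_add_atTop_nhds_zero_nat
end

section
/- For every integer l ≥ 4, the identity N_{D_l}(t) = ((l−2)/(2l−1))·N_{B_l}(t) + ( (l+1)/(2l−1) − t )·N_{B_{l−1}}(t) holds as an identity of real polynomials in t. -/
open Polynomial

theorem ND_coeff (l k : ℕ) (hl : 2 ≤ l) :
    (ND l).coeff k = (-1 : ℝ) ^ k * ((l.choose k : ℝ) * ((l + k - 2).choose k : ℝ) +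
      (if 2 ≤ k then ((l - 2).choose (k - 2) : ℝ) * ((l + k - 3).choose k : ℝ) else 0)) := by
  simp only [ND, finsetSum_coeff, coeff_C_mul_X_pow]
  rw [Finset.sum_ite_eq]
  split_ifs with h h2 h2
  · rfl
  · rfl
  · have hk : l < k := by simpa using h
    rw [Nat.choose_eq_zero_of_lt hk, Nat.choose_eq_zero_of_lt (by omega : l - 2 < k - 2)]
    simp
  · have hk : l < k := by simpa using h
    omega

/-- The coefficient identity in degree `m + 2` for `l = n + 2`. -/
theorem choose_identity (n m : ℕ) (hn : 0 < n) :
    ((n + 2).choose (m + 2) : ℝ) * ((n + m + 2).choose (m + 2) : ℝ) +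
        (n.choose m : ℝ) * ((n + m + 1).choose (m + 2) : ℝ) =
      (n : ℝ) / (2 * n + 3) *
          (((n + 2).choose (m + 2) : ℝ) * ((n + m + 3).choose (m + 2) : ℝ)) +
        ((n : ℝ) + 3) / (2 * n + 3) *
          (((n + 1).choose (m + 2) : ℝ) * ((n + m + 2).choose (m + 2) : ℝ)) +
        ((n + 1).choose (m + 1) : ℝ) * ((n + m + 1).choose (m + 1) : ℝ) := by
  have hn' : (n : ℝ) ≠ 0 := by positivity
  have h3 : (2 * n + 3 : ℝ) ≠ 0 := by positivity
  have h1 : (n + 1 : ℝ) ≠ 0 := by positivity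
  have hm1 : (m + 1 : ℝ) ≠ 0 := by positivity
  have hm2 : (m + 2 : ℝ) ≠ 0 := by positivity
  have e1 : ((n + 1).choose (m + 1) : ℝ) = (n + 1) * n.choose m / (m + 1) := by
    rw [eq_div_iff hm1]
    exact_mod_cast (Nat.add_one_mul_choose_eq n m).symm
  have e2 : ((n + 2).choose (m + 2) : ℝ) = (n + 2) * (n + 1).choose (m + 1) / (m + 2) := by
    rw [eq_div_iff hm2]
    exact_mod_cast (Nat.add_one_mul_choose_eq (n + 1) (m + 1)).symm
  have e3 : ((n + 1).choose (m + 2) : ℝ) =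
      (n + 2).choose (m + 2) - (n + 1).choose (m + 1) := by
    rw [Nat.choose_succ_succ' (n + 1) (m + 1)]
    push_cast
    ring
  have e4 : ((n + m + 2).choose (m + 2) : ℝ) =
      (n + m + 2) * (n + m + 1).choose (m + 2) / n := by
    have h := Nat.choose_mul_succ_eq (n + m + 1) (m + 2)
    rw [show n + m + 1 + 1 - (m + 2) = n by omega] at h
    rw [eq_div_iff hn', mul_comm ((n : ℝ) + m + 2)]
    exact_mod_cast h.symm
  have e5 : ((n + m + 3).choose (m + 2) : ℝ) =
      (n + m + 3) * (n + m + 2).choose (m + 2) / (n + 1) := by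
    have h := Nat.choose_mul_succ_eq (n + m + 2) (m + 2)
    rw [show n + m + 2 + 1 - (m + 2) = n + 1 by omega] at h
    rw [eq_div_iff h1, mul_comm ((n : ℝ) + m + 3)]
    exact_mod_cast h.symm
  have e6 : ((n + m + 1).choose (m + 1) : ℝ) =
      (m + 2) * (n + m + 1).choose (m + 2) / n := by
    have h := Nat.choose_succ_right_eq (n + m + 1) (m + 1)
    rw [show n + m + 1 - (m + 1) = n by omega] at h
    rw [eq_div_iff hn', mul_comm ((m : ℝ) + 2)]
    exact_mod_cast h.symm
  rw [e3, e2, e1, e5, e4, e6]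
  field_simp
  ring

/-- `N_{D_l}(t) = ((l−2)/(2l−1))·N_{B_l}(t) + ((l+1)/(2l−1) − t)·N_{B_{l−1}}(t)`. -/
theorem ND_eq_NB_combination (l : ℕ) (hl : 4 ≤ l) :
    ND l =
      Polynomial.C (((l : ℝ) - 2) / (2 * (l : ℝ) - 1)) * NB l +
      (Polynomial.C (((l : ℝ) + 1) / (2 * (l : ℝ) - 1)) - X) * NB (l - 1) := by
  obtain ⟨n, rfl⟩ : ∃ n, l = n + 2 := ⟨l - 2, by omega⟩
  have h3 : (2 * n + 3 : ℝ) ≠ 0 := by positivity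
  have c1 : ((n + 2 : ℕ) : ℝ) - 2 = n := by push_cast; ring
  have c2 : ((n + 2 : ℕ) : ℝ) + 1 = n + 3 := by push_cast; ring
  have c3 : 2 * ((n + 2 : ℕ) : ℝ) - 1 = 2 * n + 3 := by push_cast; ring
  rw [c1, c2, c3, show n + 2 - 1 = n + 1 by omega]
  ext k
  rw [sub_mul, coeff_add, coeff_sub, coeff_C_mul, coeff_C_mul, ND_coeff _ _ (by omega)]
  match k with
  | 0 =>
    simp [NB_coeff]
    field_simp
    ring
  | 1 =>
    simp [coeff_X_mul, NB_coeff]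
    field_simp
    ring
  | m + 2 =>
    rw [coeff_X_mul, NB_coeff, NB_coeff, NB_coeff, if_pos (by omega),
      show n + 2 + (m + 2) - 2 = n + m + 2 by omega, show n + 2 + (m + 2) - 3 = n + m + 1 by omega,
      show n + 2 + (m + 2) - 1 = n + m + 3 by omega, show n + 1 + (m + 2) - 1 = n + m + 2 by omega,
      show n + 1 + (m + 1) - 1 = n + m + 1 by omega, show n + 2 - 2 = n by omega,
      show m + 2 - 2 = m by omega, choose_identity n m (by omega)]
    ring
end
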